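/- arXiv:2508.06476 — 4 statements merged into one kernel-verified Lean document; each statement's English description precedes it below -/
import Mathlib

section
/- Let G be a 2-connected graph on n ≥ 3 vertices. Then for any vertex v of G, the number of connected subgraphs of G containing v is at least (n^2 + n + 2)/2, with equality if and only if G is isomorphic to the cycle C_n. -/
open SimpleGraph

/-- The number of connected subgraphs of `G` (nonempty vertex-and-edge-set pairs
that are connected). -/
noncomputable def numCS {V : Type*} (G : SimpleGraph V) : ℕ :=
  {H : G.Subgraph | H.Connected}.ncard

/-- The number of connected subgraphs of `G` containing the vertex `v`. -/
noncomputable def numCSv {V : Type*} (G : SimpleGraph V) (v : V) : ℕ :=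
  {H : G.Subgraph | H.Connected ∧ v ∈ H.verts}.ncard

/-- The number of connected subgraphs of `G` containing both `v` and `w`. -/
noncomputable def numCSvw {V : Type*} (G : SimpleGraph V) (v w : V) : ℕ :=
  {H : G.Subgraph | H.Connected ∧ v ∈ H.verts ∧ w ∈ H.verts}.ncard

/-- `v` is a cut vertex of `G`: deleting it disconnects the graph. -/
def IsCutVertex {V : Type*} (G : SimpleGraph V) (v : V) : Prop :=
  ¬ (G.induce {u | u ≠ v}).Connected

/-- `G` is 2-connected: connected, at least 3 vertices, and no cut vertex. -/
def TwoConnected {V : Type*} (G : SimpleGraph V) : Prop :=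
  G.Connected ∧ 3 ≤ Nat.card V ∧ ∀ v : V, ¬ IsCutVertex G v

/-- The star `K_{1,n-1}`: vertex `0` is the center, adjacent to all other vertices. -/
def starGraph (n : ℕ) : SimpleGraph (Fin n) :=
  SimpleGraph.fromRel (fun i _ => i.val = 0)

/-- The broom (path-star) `P_{k+1, n-k-1}`: the path `0 - 1 - ⋯ - k` together with the
leaves `k+1, …, n-1` all attached to the vertex `k`. -/
def broom (n k : ℕ) : SimpleGraph (Fin n) :=
  SimpleGraph.fromRel (fun i j => (i.val + 1 = j.val ∧ j.val ≤ k) ∨ (i.val = k ∧ k < j.val))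

/-- The lollipop `L_{n, n-k}`: the cycle `0 - 1 - ⋯ - (n-k-1) - 0` together with the
path `0 - (n-k) - (n-k+1) - ⋯ - (n-1)` attached at the cycle vertex `0`;
its pendant vertex is `n-1`. -/
def lollipop (n k : ℕ) : SimpleGraph (Fin n) :=
  SimpleGraph.fromRel (fun i j =>
    (i.val + 1 = j.val ∧ j.val ≤ n - k - 1) ∨ (i.val = 0 ∧ j.val = n - k - 1) ∨
    (i.val = 0 ∧ j.val = n - k) ∨ (i.val + 1 = j.val ∧ n - k + 1 ≤ j.val))


def CnSet {V : Type*} (G : SimpleGraph V) (s : Finset V) : Prop :=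
  (G.induce (s : Set V)).Connected

theorem aux_cross {V : Type*} {G : SimpleGraph V} {s : Set V} (hs : (G.induce s).Connected)
    (P : V → Prop) {x y : V} (hx : x ∈ s) (hy : y ∈ s) (hPx : P x) (hPy : ¬ P y) :
    ∃ a ∈ s, ∃ b ∈ s, P a ∧ ¬ P b ∧ G.Adj a b := by
  obtain ⟨p⟩ := hs.preconnected ⟨x, hx⟩ ⟨y, hy⟩
  obtain ⟨d, -, h1, h2⟩ := p.exists_boundary_dart {z | P z.1} hPx hPy
  exact ⟨d.fst.1, d.fst.2, d.snd.1, d.snd.2, h1, h2, d.adj⟩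

theorem aux_single {V : Type*} (G : SimpleGraph V) (x : V) : CnSet G {x} := by
  unfold CnSet
  have := (SimpleGraph.Subgraph.singletonSubgraph_connected (G := G) (v := x)).induce_verts
  rw [Finset.coe_singleton]; exact this

theorem aux_insert {V : Type*} [DecidableEq V] {G : SimpleGraph V} {s : Finset V} (hs : CnSet G s)
    {a x : V} (ha : a ∈ s) (h : G.Adj a x) : CnSet G (insert x s) := by
  have := connected_induce_union (G := G) (s := (s : Set V)) (t := (({x} : Finset V) : Set V))
    hs.preconnected (aux_single G x).preconnected (v := a) (w := x) (by simpa using ha) (by simp) h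
  unfold CnSet
  have e : ((insert x s : Finset V) : Set V) = (s : Set V) ∪ (({x} : Finset V) : Set V) := by
    ext; simp
  rw [e]; exact this

theorem aux_ne {V : Type*} {G : SimpleGraph V} {s : Finset V} (hs : CnSet G s) : s.Nonempty := by
  obtain ⟨⟨x, hx⟩⟩ := hs.nonempty
  exact ⟨x, by simpa using hx⟩

theorem aux_chain {V : Type*} [DecidableEq V] {G : SimpleGraph V} {A B : Finset V}
    (hA : CnSet G A) (hB : CnSet G B) (hAB : A ⊆ B) (k : ℕ) (hk : A.card + k ≤ B.card) :
    ∃ C, A ⊆ C ∧ C ⊆ B ∧ CnSet G C ∧ C.card = A.card + k := by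
  induction k with
  | zero => exact ⟨A, subset_rfl, hAB, hA, rfl⟩
  | succ k ih =>
    obtain ⟨C, h1, h2, h3, h4⟩ := ih (by omega)
    obtain ⟨y, hyB, hyC⟩ := Finset.exists_mem_notMem_of_card_lt_card (s := C) (t := B) (by omega)
    obtain ⟨x, hx⟩ := aux_ne h3
    obtain ⟨a, -, b, hb, ha, hbC, hab⟩ := aux_cross hB (fun z => z ∈ C)
      (by simpa using h2 hx) (by simpa using hyB) hx hyC
    refine ⟨insert b C, h1.trans (Finset.subset_insert _ _), ?_, aux_insert h3 ha hab, ?_⟩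
    · exact Finset.insert_subset (by simpa using hb) h2
    · rw [Finset.card_insert_of_notMem hbC]; omega

theorem aux_findw {V : Type*} [Fintype V] [DecidableEq V] {G : SimpleGraph V}
    (hG : G.Connected) (h2 : ∀ v : V, (G.induce {u | u ≠ v}).Connected)
    {A : Finset V} (hA : CnSet G A) (hS : CnSet G Aᶜ) :
    ∃ w, w ∉ A ∧ (∃ a ∈ A, G.Adj a w) ∧ (Aᶜ.card = 1 ∨ CnSet G (insert w A)ᶜ) := by
  classical
  by_cases h1 : Aᶜ.card = 1
  · obtain ⟨x, hx⟩ := aux_ne hA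
    obtain ⟨y, hy⟩ := aux_ne hS
    have hy' : y ∉ A := by simpa using hy
    obtain ⟨p⟩ := hG.preconnected x y
    obtain ⟨d, -, hd1, hd2⟩ := p.exists_boundary_dart {z | z ∈ A} hx hy'
    exact ⟨d.snd, hd2, ⟨d.fst, hd1, d.adj⟩, Or.inl h1⟩
  -- candidates
  let F : Finset (V × Finset V) := Finset.univ.filter (fun p =>
    p.1 ∉ A ∧ (∃ a ∈ A, G.Adj a p.1) ∧ CnSet G p.2 ∧ p.2 ⊆ Aᶜ ∧ p.1 ∉ p.2)
  have hF : F.Nonempty := by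
    obtain ⟨x, hx⟩ := aux_ne hA
    obtain ⟨y, hy⟩ := aux_ne hS
    have hy' : y ∉ A := by simpa using hy
    obtain ⟨p⟩ := hG.preconnected x y
    obtain ⟨d, -, hd1, hd2⟩ := p.exists_boundary_dart {z | z ∈ A} hx hy'
    have hd2' : d.snd ∉ A := hd2
    have : 1 < Aᶜ.card := by
      have := Finset.card_pos.mpr (aux_ne hS); omega
    obtain ⟨z, hz, hzd⟩ := Finset.exists_mem_ne this d.snd
    refine ⟨(d.snd, {z}), ?_⟩
    simp only [F, Finset.mem_filter, Finset.mem_univ, true_and]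
    exact ⟨hd2, ⟨d.fst, hd1, d.adj⟩, aux_single G z, by simpa using hz, by simpa using hzd.symm⟩
  obtain ⟨⟨w, T⟩, hwT, hmax⟩ := Finset.exists_max_image F (fun p => p.2.card) hF
  simp only [F, Finset.mem_filter, Finset.mem_univ, true_and] at hwT
  obtain ⟨hwA, hwa, hT, hTA, hwT⟩ := hwT
  refine ⟨w, hwA, hwa, Or.inr ?_⟩
  have key : T = (insert w A)ᶜ := by
    apply Finset.Subset.antisymm
    · intro t ht
      have h3 := hTA ht
      simp only [Finset.mem_compl, Finset.mem_insert, not_or] at h3 ⊢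
      exact ⟨fun h => hwT (h ▸ ht), h3⟩
    intro y hy
    simp only [Finset.mem_compl, Finset.mem_insert, not_or] at hy
    by_contra hyT
    -- any crossing vertex x out of T is w, and is the only neighbour of A outside T
    have cr : ∀ x, x ∉ A → x ∉ T → (∃ t ∈ T, G.Adj t x) →
        ∀ u, u ∉ A → (∃ a ∈ A, G.Adj a u) → u ∉ T → u = x := by
      intro x hxA hxT ⟨t, ht, htx⟩ u huA hua huT
      by_contra hux
      have := hmax (u, insert x T) (by
        simp only [F, Finset.mem_filter, Finset.mem_univ, true_and]
        refine ⟨huA, hua, aux_insert hT ht htx, ?_, ?_⟩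
        · exact Finset.insert_subset (by simpa using hxA) hTA
        · simp [hux, huT])
      simp only [Finset.card_insert_of_notMem hxT] at this
      omega
    obtain ⟨t, ht⟩ := aux_ne hT
    obtain ⟨a, -, x, hx, haT, hxT, hax⟩ := aux_cross hS (fun z => z ∈ T)
      (x := t) (y := w) (by exact_mod_cast hTA ht) (by simpa using hwA) ht hwT
    have hxA : x ∉ A := by simpa using hx
    have hwx := cr x hxA hxT ⟨a, haT, hax⟩ w hwA hwa hwT
    subst hwx
    obtain ⟨c, hc, d, hd, hcP, hdP, hcd⟩ := aux_cross (h2 w) (fun z => z ∈ A ∨ z ∈ T) (x := t) (y := y)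
      (fun h => hwT (h ▸ ht)) hy.1 (Or.inr ht) (by simp [hy.2, hyT])
    simp only [not_or] at hdP
    apply hd
    rcases hcP with hcA | hcT
    · exact cr w hwA hwT ⟨a, haT, hax⟩ d hdP.1 ⟨c, hcA, hcd⟩ hdP.2
    · exact (cr d hdP.1 hdP.2 ⟨c, hcT, hcd⟩ w hwA hwa hwT).symm
  rw [← key]; exact hT

open Classical in
theorem aux_count {V : Type*} [Fintype V] {G : SimpleGraph V}
    (hG : G.Connected) (h2 : ∀ v : V, (G.induce {u | u ≠ v}).Connected) (m : ℕ) :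
    ∀ A : Finset V, Aᶜ.card = m → CnSet G A → (m = 0 ∨ CnSet G Aᶜ) →
      m * (m + 1) + 2 ≤ 2 * (Finset.univ.filter (fun s : Finset V => A ⊆ s ∧ CnSet G s)).card := by
  induction m with
  | zero =>
    intro A _ hA _
    have : 0 < (Finset.univ.filter (fun s : Finset V => A ⊆ s ∧ CnSet G s)).card :=
      Finset.card_pos.mpr ⟨A, by simp [hA]⟩
    omega
  | succ m ih =>
    intro A hm hA hS
    have hS : CnSet G Aᶜ := hS.resolve_left (by omega)
    obtain ⟨w, hwA, ⟨a, haA, haw⟩, hw⟩ := aux_findw hG h2 hA hS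
    have hc : (insert w A)ᶜ.card = m := by
      rw [Finset.card_compl, Finset.card_insert_of_notMem hwA]
      rw [Finset.card_compl] at hm; omega
    have ih' := ih (insert w A) hc (aux_insert hA haA haw) (by
      rcases hw with h | h
      · left; omega
      · right; exact h)
    have hB : CnSet G ({w}ᶜ) := by
      have := h2 w
      unfold CnSet
      have e : ((({w} : Finset V)ᶜ : Finset V) : Set V) = {u | u ≠ w} := by ext; simp
      rw [e]; exact this
    have hAB : A ⊆ {w}ᶜ := by
      intro x hx; simp; rintro rfl; exact hwA hx
    have hBc : A.card + m = ({w}ᶜ : Finset V).card := by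
      rw [Finset.card_compl] at hm ⊢; simp
      have := Finset.card_le_univ A
      omega
    have hch : ∀ k : Fin (m + 1), ∃ C, A ⊆ C ∧ C ⊆ {w}ᶜ ∧ CnSet G C ∧ C.card = A.card + k :=
      fun k => aux_chain hA hB hAB k (by omega)
    choose C hC1 hC2 hC3 hC4 using hch
    have hinj : Function.Injective C := by
      intro i j hij
      have h1 := hC4 i
      have h2 := hC4 j
      rw [hij] at h1
      ext; omega
    have hsub : (Finset.univ.filter (fun s : Finset V => insert w A ⊆ s ∧ CnSet G s)) ∪
        Finset.univ.image C ⊆ Finset.univ.filter (fun s : Finset V => A ⊆ s ∧ CnSet G s) := by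
      intro s hs
      simp only [Finset.mem_union, Finset.mem_filter, Finset.mem_univ, true_and,
        Finset.mem_image] at hs ⊢
      rcases hs with ⟨h3, h4⟩ | ⟨k, rfl⟩
      · exact ⟨(Finset.subset_insert _ _).trans h3, h4⟩
      · exact ⟨hC1 k, hC3 k⟩
    have hdis : Disjoint (Finset.univ.filter (fun s : Finset V => insert w A ⊆ s ∧ CnSet G s))
        (Finset.univ.image C) := by
      rw [Finset.disjoint_left]
      intro s hs hs'
      simp only [Finset.mem_filter, Finset.mem_univ, true_and, Finset.mem_image] at hs hs'
      obtain ⟨k, rfl⟩ := hs'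
      have := hC2 k (hs.1 (Finset.mem_insert_self _ _))
      simp at this
    have := Finset.card_le_card hsub
    rw [Finset.card_union_of_disjoint hdis, Finset.card_image_of_injective _ hinj] at this
    simp only [Finset.card_univ, Fintype.card_fin] at this
    nlinarith

theorem aux_notBridge {V : Type*} [Fintype V] {G : SimpleGraph V}
    (hc : 3 ≤ Fintype.card V) (h2 : ∀ v : V, (G.induce {u | u ≠ v}).Connected)
    {a b : V} (hab : G.Adj a b) : ¬ G.IsBridge s(a, b) := by
  classical
  rw [isBridge_iff, not_not]
  obtain ⟨c, hca, hcb⟩ : ∃ c, c ≠ a ∧ c ≠ b := by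
    by_contra! h
    have : (Finset.univ : Finset V) ⊆ {a, b} := by
      intro x _
      by_cases hx : x = a
      · simp [hx]
      · simp [h x hx]
    have := Finset.card_le_card this
    rw [Finset.card_univ] at this
    have := Finset.card_le_two (a := a) (b := b)
    omega
  have key : ∀ z x y : V, x ≠ z → y ≠ z → (z = a ∨ z = b) →
      (G.deleteEdges {s(a, b)}).Reachable x y := by
    intro z x y hx hy hz
    have hr := (h2 z).preconnected ⟨x, hx⟩ ⟨y, hy⟩
    let f : G.induce {u | u ≠ z} →g G.deleteEdges {s(a, b)} :=
      { toFun := fun u => u.1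
        map_rel' := by
          rintro ⟨p, hp⟩ ⟨q, hq⟩ hpq
          simp only [Set.mem_ofPred_eq] at hp hq
          simp only [comap_adj, Function.Embedding.subtype_apply] at hpq
          rw [deleteEdges_adj]
          refine ⟨hpq, ?_⟩
          simp only [Set.mem_singleton_iff, Sym2.eq_iff]
          rcases hz with rfl | rfl <;> rintro (⟨rfl, rfl⟩ | ⟨rfl, rfl⟩) <;> simp_all }
    exact hr.map f
  exact (key b a c hab.ne hcb (Or.inr rfl)).trans (key a c b hca hab.ne' (Or.inl rfl))

open Classical in
theorem aux_lower {V : Type*} [Fintype V] {G : SimpleGraph V} (hG : G.Connected)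
    (hc : 3 ≤ Fintype.card V) (h2 : ∀ v : V, (G.induce {u | u ≠ v}).Connected) (v : V) :
    (Fintype.card V - 1) * (Fintype.card V) + 2 + 2 * G.edgeFinset.card ≤ 2 * numCSv G v := by
  have h1 := aux_count hG h2 (Fintype.card V - 1) {v} (by simp [Finset.card_compl])
    (aux_single G v) (Or.inr (by
      have := h2 v
      unfold CnSet
      have e : ((({v} : Finset V)ᶜ : Finset V) : Set V) = {u | u ≠ v} := by ext; simp
      rw [e]; exact this))
  rw [Nat.sub_add_cancel (by omega)] at h1
  set K := Finset.univ.filter (fun s : Finset V => {v} ⊆ s ∧ CnSet G s) with hK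
  have h3 : K.card + G.edgeFinset.card ≤ numCSv G v := by
    let f : Finset V → G.Subgraph := fun s => (⊤ : G.Subgraph).induce (s : Set V)
    let g : Sym2 V → G.Subgraph := fun e => toSubgraph (G.deleteEdges {e}) (deleteEdges_le _)
    have hf : Set.InjOn f K := by
      intro s _ t _ hst
      have := congrArg Subgraph.verts hst
      simpa [f] using this
    have hg : Set.InjOn g G.edgeFinset := by
      intro s hs t ht hst
      by_contra hne
      have hs' : s ∈ G.edgeSet := by simpa using hs
      induction s with | h x y =>
      have := congrFun (congrFun (congrArg Subgraph.Adj hst) x) y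
      have hxy : G.Adj x y := by simpa using hs'
      simp [g, deleteEdges_adj, hxy, toSubgraph] at this
      exact hne this
    have hdis : Disjoint (K.image f) (G.edgeFinset.image g) := by
      rw [Finset.disjoint_left]
      intro H h1 h2
      simp only [Finset.mem_image] at h1 h2
      obtain ⟨s, -, rfl⟩ := h1
      obtain ⟨e, he, hes⟩ := h2
      induction e with | h x y =>
      have hxy : G.Adj x y := by simpa using he
      have hv := congrArg Subgraph.verts hes
      have := congrFun (congrFun (congrArg Subgraph.Adj hes) x) y
      have hs : (s : Set V) = Set.univ := by simpa [f, g, toSubgraph] using hv.symm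
      have hs' : ∀ z, z ∈ s := fun z => by
        have : z ∈ (s : Set V) := hs ▸ Set.mem_univ z
        simpa using this
      simp [f, g, deleteEdges_adj, hxy, toSubgraph, hs'] at this
    have hsub : ((K.image f ∪ G.edgeFinset.image g : Finset G.Subgraph) : Set G.Subgraph) ⊆
        {H : G.Subgraph | H.Connected ∧ v ∈ H.verts} := by
      intro H hH
      simp only [Finset.coe_union, Finset.coe_image, Set.mem_union, Set.mem_image,
        Finset.mem_coe] at hH
      rcases hH with ⟨s, hs, rfl⟩ | ⟨e, he, rfl⟩
      · rw [hK, Finset.mem_filter] at hs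
        refine ⟨connected_induce_iff.mp hs.2.2, ?_⟩
        have := hs.2.1
        simpa [f] using this
      · induction e with | h x y =>
        have hxy : G.Adj x y := by simpa using he
        refine ⟨(hG.connected_delete_edge_of_not_isBridge (aux_notBridge hc h2 hxy)).toSubgraph _, ?_⟩
        simp [g, toSubgraph]
    have := Set.ncard_le_ncard hsub (Set.toFinite _)
    rw [Set.ncard_coe_finset, Finset.card_union_of_disjoint hdis, Finset.card_image_of_injOn hf,
      Finset.card_image_of_injOn hg] at this
    exact this
  omega

open Classical in
theorem aux_deg {V : Type*} [Fintype V] {G : SimpleGraph V} (hG : G.Connected)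
    (hc : 3 ≤ Fintype.card V) (h2 : ∀ v : V, (G.induce {u | u ≠ v}).Connected) (v : V) :
    2 ≤ G.degree v := by
  have : Nontrivial V := Fintype.one_lt_card_iff_nontrivial.mp (by omega)
  obtain ⟨w, hw⟩ := hG.preconnected.exists_adj_of_nontrivial v
  obtain ⟨c, hca, hcb⟩ : ∃ c, c ≠ v ∧ c ≠ w := by
    by_contra! h
    have : (Finset.univ : Finset V) ⊆ {v, w} := by
      intro x _
      by_cases hx : x = v
      · simp [hx]
      · simp [h x hx]
    have := Finset.card_le_card this
    rw [Finset.card_univ] at this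
    have := Finset.card_le_two (a := v) (b := w)
    omega
  obtain ⟨a, ha, b, hb, hP, hQ, hab⟩ := aux_cross (h2 w) (fun z => z = v) (x := v) (y := c)
    hw.ne hcb rfl hca
  subst hP
  have : ({w, b} : Finset V) ⊆ G.neighborFinset a := by
    intro x hx
    simp only [Finset.mem_insert, Finset.mem_singleton] at hx
    rcases hx with rfl | rfl <;> simpa
  have := Finset.card_le_card this
  rwa [Finset.card_pair (Ne.symm hb), card_neighborFinset_eq_degree] at this

theorem aux_iso {V : Type*} [Fintype V] {G : SimpleGraph V} (hG : G.Connected)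
    (hna : ¬ G.IsAcyclic) (hd : ∀ v, (G.neighborSet v).ncard = 2) :
    Nonempty (G ≃g cycleGraph (Fintype.card V)) := by
  classical
  rw [isAcyclic_iff_free_cycleGraph] at hna
  push Not at hna
  obtain ⟨k, hk, hfree⟩ := hna
  obtain ⟨⟨φ, hinj⟩⟩ := hfree
  obtain ⟨m, rfl⟩ : ∃ m, k = m + 3 := ⟨k - 3, by omega⟩
  have hnb : ∀ i, G.neighborSet (φ i) = φ '' ((cycleGraph (m + 3)).neighborSet i) := by
    intro i
    symm
    apply Set.eq_of_subset_of_ncard_le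
    · rintro _ ⟨j, hj, rfl⟩
      exact φ.map_adj hj
    · rw [hd, Set.ncard_image_of_injective _ hinj]
      have := cycleGraph_degree_three_le (n := m) (v := i)
      rw [← card_neighborSet_eq_degree, ← Nat.card_eq_fintype_card, Nat.card_coe_set_eq] at this
      exact this.ge
    · exact Set.toFinite _
  have hsurj : Function.Surjective φ := by
    intro y
    by_contra hy
    obtain ⟨p⟩ := hG.preconnected (φ 0) y
    obtain ⟨d, -, h1, h2⟩ := p.exists_boundary_dart (Set.range φ) ⟨0, rfl⟩ hy
    obtain ⟨i, hi⟩ := h1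
    have : d.snd ∈ G.neighborSet (φ i) := by rw [hi]; exact d.adj
    rw [hnb] at this
    obtain ⟨j, -, hj⟩ := this
    exact h2 ⟨j, hj⟩
  let e := Equiv.ofBijective φ ⟨hinj, hsurj⟩
  have hcard : Fintype.card V = m + 3 := by
    rw [← Fintype.card_congr e]; simp
  rw [hcard]
  refine ⟨RelIso.symm ⟨e, ?_⟩⟩
  intro a b
  constructor
  · intro h
    have : φ b ∈ G.neighborSet (φ a) := h
    rw [hnb] at this
    obtain ⟨j, hj, hjb⟩ := this
    rw [← hinj hjb]; exact hj
  · exact fun h => φ.map_adj h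

theorem aux_cross' {V : Type*} {G : SimpleGraph V} {H : G.Subgraph} (hs : H.Connected)
    (P : V → Prop) {x y : V} (hx : x ∈ H.verts) (hy : y ∈ H.verts) (hPx : P x) (hPy : ¬ P y) :
    ∃ a b, P a ∧ ¬ P b ∧ H.Adj a b := by
  obtain ⟨p⟩ := hs.preconnected.coe ⟨x, hx⟩ ⟨y, hy⟩
  obtain ⟨d, -, h1, h2⟩ := p.exists_boundary_dart {z | P z.1} hPx hPy
  exact ⟨d.fst.1, d.snd.1, h1, h2, d.adj⟩

theorem aux_val {m : ℕ} (i : Fin (m + 3)) :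
    ((i + 1 : Fin (m + 3)).val = i.val + 1 ∧ i.val + 1 < m + 3) ∨
    ((i + 1 : Fin (m + 3)).val = 0 ∧ i.val + 1 = m + 3) := by
  have := Fin.val_add_one i
  have hi := i.2
  by_cases h : i = Fin.last (m + 2)
  · right
    rw [if_pos h] at this
    refine ⟨this, ?_⟩
    rw [h]; simp
  · left
    rw [if_neg h] at this
    refine ⟨this, ?_⟩
    have : i.val ≠ m + 2 := fun h' => h (Fin.ext h')
    omega

open Classical in
noncomputable def auxAbs {V : Type*} {G : SimpleGraph V} {m : ℕ} (g : Fin (m + 3) ≃ V)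
    (H : G.Subgraph) : Finset (Fin (m + 3)) :=
  Finset.univ.filter (fun i => ¬ H.Adj (g i) (g (i + 1)))

theorem aux_struct {V : Type*} {G : SimpleGraph V} {m : ℕ} (g : Fin (m + 3) ≃ V)
    (hg : ∀ i j, G.Adj (g i) (g j) → j = i + 1 ∨ i = j + 1)
    (H : G.Subgraph) (hH : H.Connected) (h0 : g 0 ∈ H.verts) (a b : Fin (m + 3))
    (ha : a ∈ auxAbs g H) (hb : b ∈ auxAbs g H)
    (hmin : ∀ i ∈ auxAbs g H, a ≤ i) (hmax : ∀ i ∈ auxAbs g H, i ≤ b) :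
    (∀ x, g x ∈ H.verts ↔ (x ≤ a ∨ b < x)) ∧
    (∀ i, H.Adj (g i) (g (i + 1)) ↔ (i < a ∨ b < i)) := by
  have hpres : ∀ i, (i < a ∨ b < i) → H.Adj (g i) (g (i + 1)) := by
    intro i hi
    by_contra h
    have hm : i ∈ auxAbs g H := by simp [auxAbs, h]
    rcases hi with hi | hi
    · exact absurd (hmin i hm) (not_le.mpr hi)
    · exact absurd (hmax i hm) (not_le.mpr hi)
  have ha' : ¬ H.Adj (g a) (g (a + 1)) := by simpa [auxAbs] using ha
  have hb' : ¬ H.Adj (g b) (g (b + 1)) := by simpa [auxAbs] using hb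
  have hv1 : ∀ x, (x ≤ a ∨ b < x) → g x ∈ H.verts := by
    intro x hx
    by_cases h : x < a ∨ b < x
    · exact (hpres x h).fst_mem
    · have hxa : x = a := by
        rcases hx with hx | hx
        · exact le_antisymm hx (not_lt.mp fun h' => h (Or.inl h'))
        · exact absurd (Or.inr hx) h
      subst hxa
      by_cases hx0 : x.val = 0
      · have : x = 0 := Fin.ext hx0
        rw [this]; exact h0
      · have hx2 := x.2
        let j : Fin (m + 3) := ⟨x.val - 1, by omega⟩
        have hj : j + 1 = x := by
          apply Fin.ext
          rcases aux_val j with h1 | h1 <;> simp only [j] at h1 ⊢ <;> omega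
        have := (hpres j (Or.inl (by rw [Fin.lt_def]; simp only [j]; omega))).snd_mem
        rwa [hj] at this
  have hv2 : ∀ x, g x ∈ H.verts → (x ≤ a ∨ b < x) := by
    intro x hx
    by_contra hcon
    push Not at hcon
    obtain ⟨p, q, hp, hq, hpq⟩ := aux_cross' hH (fun z => a < g.symm z ∧ g.symm z ≤ b)
      (x := g x) (y := g 0) hx h0 (by simpa using hcon) (by simp)
    obtain ⟨i, rfl⟩ := g.surjective p
    obtain ⟨j, rfl⟩ := g.surjective q
    simp only [Equiv.symm_apply_apply, Fin.lt_def, Fin.le_def] at hp hq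
    rcases hg i j hpq.adj_sub with rfl | rfl
    · have hib : i = b := by
        apply Fin.ext
        have := b.2
        rcases aux_val i with h1 | h1 <;> omega
      exact hb' (hib ▸ hpq)
    · have hja : j = a := by
        apply Fin.ext
        rcases aux_val j with h1 | h1 <;> omega
      exact ha' (hja ▸ hpq.symm)
  refine ⟨fun x => ⟨hv2 x, hv1 x⟩, fun i => ⟨fun h => ?_, hpres i⟩⟩
  rcases hv2 i h.fst_mem with h1 | h1
  · rcases h1.lt_or_eq with h1 | h1
    · exact Or.inl h1
    · subst h1; exact absurd h ha'
  · exact Or.inr h1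

theorem aux_ext {V : Type*} {G : SimpleGraph V} {m : ℕ} (g : Fin (m + 3) ≃ V)
    (hg : ∀ i j, G.Adj (g i) (g j) → j = i + 1 ∨ i = j + 1) (H H' : G.Subgraph)
    (hv : ∀ x, g x ∈ H.verts ↔ g x ∈ H'.verts)
    (he : ∀ i, H.Adj (g i) (g (i + 1)) ↔ H'.Adj (g i) (g (i + 1))) : H = H' := by
  apply Subgraph.ext
  · ext z
    obtain ⟨i, rfl⟩ := g.surjective z
    exact hv i
  · ext p q
    obtain ⟨i, rfl⟩ := g.surjective p
    obtain ⟨j, rfl⟩ := g.surjective q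
    by_cases h : G.Adj (g i) (g j)
    · rcases hg i j h with rfl | rfl
      · exact he i
      · rw [H.adj_comm, H'.adj_comm]; exact he j
    · exact ⟨fun h' => absurd h'.adj_sub h, fun h' => absurd h'.adj_sub h⟩

open Classical in
noncomputable def auxEnc {V : Type*} {G : SimpleGraph V} {m : ℕ} (g : Fin (m + 3) ≃ V)
    (H : G.Subgraph) : Option (Sym2 (Fin (m + 3))) :=
  if h : (auxAbs g H).Nonempty then some s((auxAbs g H).min' h, (auxAbs g H).max' h) else none

theorem aux_upper' {V : Type*} {G : SimpleGraph V} {m : ℕ} (g : Fin (m + 3) ≃ V)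
    (hg : ∀ i j, G.Adj (g i) (g j) → j = i + 1 ∨ i = j + 1) :
    2 * numCSv G (g 0) ≤ (m + 3) ^ 2 + (m + 3) + 2 := by
  classical
  have hinj : Set.InjOn (auxEnc (G := G) g) {H : G.Subgraph | H.Connected ∧ g 0 ∈ H.verts} := by
    rintro H ⟨hH, h0⟩ H' ⟨hH', h0'⟩ heq
    unfold auxEnc at heq
    by_cases h : (auxAbs g H).Nonempty <;> by_cases h' : (auxAbs g H').Nonempty
    · rw [dif_pos h, dif_pos h', Option.some.injEq] at heq
      have hle := Finset.min'_le_max' _ h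
      have hle' := Finset.min'_le_max' _ h'
      have hs := aux_struct g hg H hH h0 _ _ (Finset.min'_mem _ h) (Finset.max'_mem _ h)
        (fun i hi => Finset.min'_le _ i hi) (fun i hi => Finset.le_max' _ i hi)
      have hs' := aux_struct g hg H' hH' h0' _ _ (Finset.min'_mem _ h') (Finset.max'_mem _ h')
        (fun i hi => Finset.min'_le _ i hi) (fun i hi => Finset.le_max' _ i hi)
      have e1 : (auxAbs g H).min' h = (auxAbs g H').min' h' ∧
          (auxAbs g H).max' h = (auxAbs g H').max' h' := by
        rcases Sym2.eq_iff.mp heq with h1 | ⟨h1, h2⟩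
        · exact h1
        · constructor
          · apply le_antisymm
            · rw [h2] at hle; exact hle
            · rw [h1]; exact hle'
          · apply le_antisymm
            · rw [h2]; exact hle'
            · rw [h1] at hle; exact hle
      rw [e1.1, e1.2] at hs
      exact aux_ext g hg H H' (fun x => (hs.1 x).trans (hs'.1 x).symm)
        (fun x => (hs.2 x).trans (hs'.2 x).symm)
    · rw [dif_pos h, dif_neg h'] at heq; cases heq
    · rw [dif_neg h, dif_pos h'] at heq; cases heq
    · have hall : ∀ H : G.Subgraph, ¬ (auxAbs g H).Nonempty → ∀ i, H.Adj (g i) (g (i + 1)) := by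
        intro H h i
        by_contra hi
        exact h ⟨i, by simp [auxAbs, hi]⟩
      exact aux_ext g hg H H'
        (fun x => iff_of_true (hall H h x).fst_mem (hall H' h' x).fst_mem)
        (fun x => iff_of_true (hall H h x) (hall H' h' x))
  have h1 := Set.ncard_le_ncard_of_injOn (t := Set.univ) (auxEnc (G := G) g)
    (fun _ _ => Set.mem_univ _) hinj (Set.toFinite _)
  rw [Set.ncard_univ, Nat.card_eq_fintype_card, Fintype.card_option, Sym2.card, Fintype.card_fin]
    at h1
  have h2 : (m + 3 + 1).choose 2 * 2 = (m + 3 + 1) * (m + 3) := by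
    rw [Nat.choose_two_right]
    exact Nat.div_mul_cancel (Nat.even_mul_pred_self _).two_dvd
  unfold numCSv
  nlinarith

theorem aux_upper {V : Type*} [Fintype V] {G : SimpleGraph V} (hc : 3 ≤ Fintype.card V)
    (f : G ≃g cycleGraph (Fintype.card V)) (v : V) :
    2 * numCSv G v ≤ Fintype.card V ^ 2 + Fintype.card V + 2 := by
  obtain ⟨m, hm⟩ : ∃ m, Fintype.card V = m + 3 := ⟨Fintype.card V - 3, by omega⟩
  rw [hm] at f ⊢
  let g : Fin (m + 3) ≃ V := (Equiv.addRight (f v)).trans f.symm.toEquiv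
  have hgi : ∀ i, g i = f.symm (i + f v) := fun i => rfl
  have h0 : g 0 = v := by rw [hgi]; simp
  rw [← h0]
  apply aux_upper'
  intro i j h
  rw [hgi, hgi, f.symm.map_adj_iff] at h
  rcases cycleGraph_adj.mp h with h | h
  · right
    rw [add_sub_add_right_eq_sub] at h
    rw [sub_eq_iff_eq_add] at h
    exact h.trans (add_comm _ _)
  · left
    rw [add_sub_add_right_eq_sub] at h
    rw [sub_eq_iff_eq_add] at h
    exact h.trans (add_comm _ _)

theorem numCSv_twoConnected {V : Type*} [Fintype V] (G : SimpleGraph V) (n : ℕ)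
    (hn : Fintype.card V = n) (hn3 : 3 ≤ n) (h2c : TwoConnected G) :
    ∀ v : V, n ^ 2 + n + 2 ≤ 2 * numCSv G v ∧
      (2 * numCSv G v = n ^ 2 + n + 2 ↔ Nonempty (G ≃g cycleGraph n)) := by
  classical
  intro v
  obtain ⟨hG, -, h2'⟩ := h2c
  have h2 : ∀ v : V, (G.induce {u | u ≠ v}).Connected := fun v => not_not.mp (h2' v)
  subst hn
  have hlow := aux_lower hG hn3 h2 v
  have hdeg := aux_deg hG hn3 h2
  have hsum := G.sum_degrees_eq_twice_card_edges
  have hge : ∑ _v : V, 2 ≤ ∑ v, G.degree v := Finset.sum_le_sum fun v _ => by convert hdeg v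
  have hE : Fintype.card V ≤ G.edgeFinset.card := by
    simp only [Finset.sum_const, Finset.card_univ, smul_eq_mul] at hge
    rw [hsum] at hge; omega
  have hsq : (Fintype.card V - 1) * Fintype.card V + 2 + 2 * Fintype.card V
      = Fintype.card V ^ 2 + Fintype.card V + 2 := by
    obtain ⟨k, hk⟩ : ∃ k, Fintype.card V = k + 1 := ⟨Fintype.card V - 1, by omega⟩
    rw [hk, Nat.add_sub_cancel]; ring
  have hlow' : Fintype.card V ^ 2 + Fintype.card V + 2 ≤ 2 * numCSv G v := by omega
  refine ⟨hlow', ?_, ?_⟩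
  · intro heq
    have hE' : G.edgeFinset.card = Fintype.card V := by
      have : (Fintype.card V - 1) * Fintype.card V + 2 + 2 * G.edgeFinset.card ≤
        Fintype.card V ^ 2 + Fintype.card V + 2 := by rw [← heq]; convert hlow
      omega
    apply aux_iso hG
    · intro hac
      have : Nontrivial V := Fintype.one_lt_card_iff_nontrivial.mp (by omega)
      obtain ⟨w, hw⟩ := hG.preconnected.exists_adj_of_nontrivial v
      exact aux_notBridge hn3 h2 hw (isAcyclic_iff_forall_isBridge.mp hac hw)
    · intro x
      have hs : ∑ v : V, 2 = ∑ v, G.degree v := by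
        rw [hsum, hE']; simp [mul_comm]
      have := (Finset.sum_eq_sum_iff_of_le (fun v _ => by convert hdeg v)).mp hs x (Finset.mem_univ x)
      rw [← Nat.card_coe_set_eq, Nat.card_eq_fintype_card, card_neighborSet_eq_degree]
      exact this.symm
  · rintro ⟨f⟩
    exact le_antisymm (aux_upper hn3 f v) hlow'
end

section
/- Let G be a 2-connected graph on n vertices not isomorphic to C_n, and let u, v be any two vertices of G. Then the number of connected subgraphs of G containing both u and v is strictly greater than (n^2 - n + 4)/2; in particular it exceeds f_{C_n}(u', v') for every pair of vertices u', v' of C_n. -/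
open SimpleGraph

namespace EarProof

universe uu
variable {V : Type uu} {G : SimpleGraph V}

/-- portion of a path kept -/
def seg {a b : V} (R : G.Walk a b) : Option (ℕ × ℕ) → G.Subgraph
  | none => R.toSubgraph
  | some ij => (R.take ij.1).toSubgraph ⊔ (R.drop ij.2).toSubgraph

/-- the two ends -/
def ends (G : SimpleGraph V) (a b : V) : G.Subgraph :=
  G.singletonSubgraph a ⊔ G.singletonSubgraph b

open Classical in
/-- broken options of a path keeping the vertices of `X` -/
noncomputable def brk (X : Set V) {a b : V} (R : G.Walk a b) : Finset (ℕ × ℕ) :=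
  (Finset.range (R.length + 1) ×ˢ Finset.range (R.length + 1)).filter
    (fun ij => ij.1 < ij.2 ∧ ∀ k, ij.1 < k → k < ij.2 → R.getVert k ∉ X)

open Classical in
/-- all options -/
noncomputable def opts (X : Set V) {a b : V} (R : G.Walk a b) : Finset (Option (ℕ × ℕ)) :=
  insert none ((brk X R).image some)

lemma mem_brk {X : Set V} {a b : V} {R : G.Walk a b} {i j : ℕ} :
    (i, j) ∈ brk X R ↔ i < j ∧ j ≤ R.length ∧ ∀ k, i < k → k < j → R.getVert k ∉ X := by
  simp only [brk, Finset.mem_filter, Finset.mem_product, Finset.mem_range]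
  constructor
  · rintro ⟨⟨h1, h2⟩, h3, h4⟩
    exact ⟨h3, by omega, h4⟩
  · rintro ⟨h1, h2, h3⟩
    exact ⟨⟨by omega, by omega⟩, h1, h3⟩

lemma some_mem_opts {X : Set V} {a b : V} {R : G.Walk a b} {i j : ℕ} :
    some (i, j) ∈ opts X R ↔ i < j ∧ j ≤ R.length ∧ ∀ k, i < k → k < j → R.getVert k ∉ X := by
  rw [← mem_brk]; simp [opts]

lemma none_mem_opts {X : Set V} {a b : V} {R : G.Walk a b} : none ∈ opts X R := by
  simp [opts]

lemma card_opts {X : Set V} {a b : V} {R : G.Walk a b} :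
    (opts X R).card = (brk X R).card + 1 := by
  rw [opts, Finset.card_insert_of_notMem (by simp),
    Finset.card_image_of_injective _ (Option.some_injective _)]

lemma start_mem_seg {a b : V} (R : G.Walk a b) (o : Option (ℕ × ℕ)) : a ∈ (seg R o).verts := by
  rcases o with _ | ⟨i, j⟩
  · simp [seg]
  · simp [seg]

lemma end_mem_seg {a b : V} (R : G.Walk a b) (o : Option (ℕ × ℕ)) : b ∈ (seg R o).verts := by
  rcases o with _ | ⟨i, j⟩
  · simp [seg]
  · exact Or.inr (Walk.end_mem_verts_toSubgraph _)

lemma ends_le {a b : V} {H : G.Subgraph} (ha : a ∈ H.verts) (hb : b ∈ H.verts) :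
    ends G a b ≤ H := by
  simp only [ends, sup_le_iff, singletonSubgraph_le_iff]
  exact ⟨ha, hb⟩

lemma ends_le_seg {a b : V} (R : G.Walk a b) (o : Option (ℕ × ℕ)) : ends G a b ≤ seg R o :=
  ends_le (start_mem_seg R o) (end_mem_seg R o)

lemma seg_le {a b : V} (R : G.Walk a b) (o : Option (ℕ × ℕ)) : seg R o ≤ R.toSubgraph := by
  rcases o with _ | ⟨i, j⟩
  · exact le_rfl
  · have h1 := congrArg Walk.toSubgraph (R.append_take_drop_eq i)
    have h2 := congrArg Walk.toSubgraph (R.append_take_drop_eq j)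
    rw [Walk.toSubgraph_append] at h1 h2
    refine sup_le ?_ ?_
    · exact le_sup_left.trans h1.le
    · exact le_sup_right.trans h2.le

lemma seg_connected {a b : V} (R : G.Walk a b) {H : G.Subgraph} (hH : H.Connected)
    (ha : a ∈ H.verts) (hb : b ∈ H.verts) (o : Option (ℕ × ℕ)) : (H ⊔ seg R o).Connected := by
  rcases o with _ | ⟨i, j⟩
  · exact Subgraph.connected_sup hH.preconnected R.toSubgraph_connected.preconnected
      ⟨a, by simp [seg, ha]⟩
  · have h1 : (H ⊔ (R.take i).toSubgraph).Connected :=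
      Subgraph.connected_sup hH.preconnected (R.take i).toSubgraph_connected.preconnected
      ⟨a, by simp [ha]⟩
    have h2 := Subgraph.connected_sup h1.preconnected (R.drop j).toSubgraph_connected.preconnected
      ⟨b, Or.inl hb, Walk.end_mem_verts_toSubgraph _⟩
    simpa [seg, sup_assoc] using h2

lemma seg_verts {X : Set V} {a b : V} {R : G.Walk a b} {o : Option (ℕ × ℕ)} (ho : o ∈ opts X R)
    {x : V} (hx : x ∈ X) (hxR : x ∈ R.support) : x ∈ (seg R o).verts := by
  rcases o with _ | ⟨i, j⟩
  · simpa [seg] using hxR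
  · rw [some_mem_opts] at ho
    obtain ⟨h1, h2, h3⟩ := ho
    rw [Walk.mem_support_iff_exists_getVert] at hxR
    obtain ⟨k, rfl, hk⟩ := hxR
    simp only [seg, Subgraph.verts_sup, Set.mem_union, Walk.mem_verts_toSubgraph,
      Walk.mem_support_iff_exists_getVert]
    by_cases hki : k ≤ i
    · left
      exact ⟨k, by simp [Walk.take_getVert, hki], by simp [Walk.take_length]; omega⟩
    by_cases hkj : j ≤ k
    · right
      refine ⟨k - j, ?_, ?_⟩
      · rw [Walk.drop_getVert]; congr 1; omega
      · rw [Walk.drop_length]; omega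
    · exact absurd hx (h3 k (by omega) (by omega))

lemma seg_adj {a b : V} {R : G.Walk a b} (hR : R.IsPath) {i j k : ℕ} (hj : j ≤ R.length)
    (hi : i ≤ R.length) (hk : k < R.length) :
    (seg R (some (i, j))).Adj (R.getVert k) (R.getVert (k+1)) ↔ k < i ∨ j ≤ k := by
  have key : ∀ l, l < R.length → s(R.getVert l, R.getVert (l+1)) =
      s(R.getVert k, R.getVert (k+1)) → l = k := by
    intro l hl h
    have inj := hR.getVert_injOn
    rw [Sym2.eq_iff] at h
    rcases h with ⟨h, -⟩ | ⟨h, h'⟩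
    · exact inj (by simp; omega) (by simp; omega) h
    · have e1 := inj (by simp; omega) (by simp; omega) h
      have e2 := inj (by simp; omega) (by simp; omega) h'
      omega
  simp only [seg, Subgraph.sup_adj, Walk.toSubgraph_adj_iff, Walk.take_getVert, Walk.drop_getVert,
    Walk.take_length, Walk.drop_length]
  constructor
  · rintro (⟨l, h, hl⟩ | ⟨l, h, hl⟩)
    · left
      rw [min_eq_right (by omega), min_eq_right (by omega)] at h
      have := key l (by omega) h
      omega
    · right
      have := key (j + l) (by omega) (by simpa [add_assoc] using h)
      omega
  · rintro (h | h)
    · left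
      refine ⟨k, ?_, by omega⟩
      rw [min_eq_right (by omega), min_eq_right (by omega)]
    · right
      refine ⟨k - j, ?_, by omega⟩
      have e1 : j + (k - j) = k := by omega
      have e2 : j + (k - j + 1) = k + 1 := by omega
      rw [e1, e2]

lemma seg_inj {X : Set V} {a b : V} {R : G.Walk a b} (hR : R.IsPath) {o o' : Option (ℕ × ℕ)}
    (ho : o ∈ opts X R) (ho' : o' ∈ opts X R) (h : seg R o = seg R o') : o = o' := by
  have full : ∀ k, k < R.length → (seg R none).Adj (R.getVert k) (R.getVert (k+1)) :=
    fun k hk => R.toSubgraph_adj_getVert hk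
  rcases o with _ | ⟨i, j⟩ <;> rcases o' with _ | ⟨i', j'⟩
  · rfl
  · exfalso
    rw [some_mem_opts] at ho'
    have := full i' (by omega)
    rw [h, seg_adj hR (by omega) (by omega) (by omega)] at this
    omega
  · exfalso
    rw [some_mem_opts] at ho
    have := full i (by omega)
    rw [← h, seg_adj hR (by omega) (by omega) (by omega)] at this
    omega
  · rw [some_mem_opts] at ho ho'
    have key : ∀ k, k < R.length → ((k < i ∨ j ≤ k) ↔ (k < i' ∨ j' ≤ k)) := by
      intro k hk
      rw [← seg_adj hR (by omega) (by omega) hk, h, seg_adj hR (by omega) (by omega) hk]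
    have k1 := key i (by omega)
    have k2 := key i' (by omega)
    have k3 := key (j-1) (by omega)
    have k4 := key (j'-1) (by omega)
    have e1 : i = i' := by omega
    have e2 : j = j' := by omega
    rw [e1, e2]

lemma seg_zero {a b : V} (R : G.Walk a b) : seg R (some (0, R.length)) ≤ ends G a b := by
  have h0 : ∀ {c d : V} (W : G.Walk c d), W.length = 0 → W.toSubgraph = G.singletonSubgraph c := by
    intro c d W hW
    cases W with
    | nil => rfl
    | cons h p => simp at hW
  have h1 : (R.take 0).toSubgraph = G.singletonSubgraph a := h0 _ (by simp)
  have h2 : (R.drop R.length).toSubgraph = G.singletonSubgraph b := by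
    rw [h0 _ (by simp [Walk.drop_length]), Walk.getVert_length]
  simp only [seg, ends]
  rw [h1, h2]

/-! ### ear counting -/

/-- connected subgraphs of `S` containing `X` -/
def cs (S : G.Subgraph) (X : Set V) : Set G.Subgraph :=
  {H | H ≤ S ∧ H.Connected ∧ X ⊆ H.verts}

lemma sup_seg_inf {a b : V} {R : G.Walk a b} {S H : G.Subgraph}
    (hSR : S ⊓ R.toSubgraph ≤ ends G a b) (hH : H ≤ S) (o : Option (ℕ × ℕ)) :
    (H ⊔ seg R o) ⊓ R.toSubgraph = seg R o := by
  rw [inf_sup_right, inf_eq_left.2 (seg_le R o)]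
  refine sup_eq_right.2 ?_
  exact ((inf_le_inf_right _ hH).trans hSR).trans (ends_le_seg R o)

lemma sup_seg_inf' {a b : V} {R : G.Walk a b} {S H : G.Subgraph}
    (hSR : S ⊓ R.toSubgraph ≤ ends G a b) (hH : H ≤ S) (ha : a ∈ H.verts) (hb : b ∈ H.verts)
    (o : Option (ℕ × ℕ)) :
    (H ⊔ seg R o) ⊓ S = H := by
  rw [inf_sup_right, inf_eq_left.2 hH]
  refine sup_eq_left.2 ?_
  rw [inf_comm]
  exact ((inf_le_inf_left _ (seg_le R o)).trans hSR).trans (ends_le ha hb)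

lemma ear_span [Finite V] {a b : V} {R : G.Walk a b} (hR : R.IsPath) {S : G.Subgraph}
    (ha : a ∈ S.verts) (hb : b ∈ S.verts)
    (hSR : S ⊓ R.toSubgraph ≤ ends G a b) :
    (cs S S.verts).ncard * (opts Set.univ R).card
      ≤ (cs (S ⊔ R.toSubgraph) (S ⊔ R.toSubgraph).verts).ncard := by
  rw [← Set.ncard_coe_finset, ← Set.ncard_prod]
  refine Set.ncard_le_ncard_of_injOn (fun p => p.1 ⊔ seg R p.2) ?_ ?_ (Set.toFinite _)
  · rintro ⟨H, o⟩ ⟨⟨h1, h2, h3⟩, ho⟩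
    refine ⟨sup_le_sup h1 (seg_le R o), seg_connected R h2 (h3 ha) (h3 hb) o, ?_⟩
    rintro x (hx | hx)
    · exact Or.inl (h3 hx)
    · exact Or.inr (seg_verts ho (Set.mem_univ x) (by simpa using hx))
  · rintro ⟨H, o⟩ ⟨⟨h1, h2, h3⟩, ho⟩ ⟨H', o'⟩ ⟨⟨h1', h2', h3'⟩, ho'⟩ h
    simp only at h h1 h1' h3 h3'
    have e1 : H = H' := by
      rw [← sup_seg_inf' hSR h1 (h3 ha) (h3 hb) o, h, sup_seg_inf' hSR h1' (h3' ha) (h3' hb) o']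
    have e2 : o = o' := by
      apply seg_inj hR ho ho'
      rw [← sup_seg_inf hSR h1 o, h, sup_seg_inf hSR h1' o']
    rw [e1, e2]

lemma ear_pair [Finite V] {a b : V} {R : G.Walk a b} (hR : R.IsPath) (hab : a ≠ b)
    {S : G.Subgraph}
    (ha : a ∈ S.verts) (hb : b ∈ S.verts)
    (hSR : S ⊓ R.toSubgraph ≤ ends G a b) {X : Set V} (hX : X ⊆ S.verts) :
    (cs S X).ncard + (cs S S.verts).ncard * (brk (∅ : Set V) R).card
      ≤ (cs (S ⊔ R.toSubgraph) X).ncard := by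
  have hlen : 0 < R.length := by
    rw [Nat.pos_iff_ne_zero]
    intro h0
    exact hab (Walk.eq_of_length_eq_zero h0)
  have hz : some (0, R.length) ∈ opts (∅ : Set V) R := by
    rw [some_mem_opts]; simp [hlen]
  classical
  set O := (opts (∅ : Set V) R).erase (some (0, R.length)) with hO
  have hOc : O.card = (brk (∅ : Set V) R).card := by
    rw [hO, Finset.card_erase_of_mem hz, card_opts]; rfl
  set f : G.Subgraph × Option (ℕ × ℕ) → G.Subgraph := fun p => p.1 ⊔ seg R p.2 with hf
  have hinj : Set.InjOn f (cs S S.verts ×ˢ (O : Set (Option (ℕ × ℕ)))) := by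
    rintro ⟨H, o⟩ ⟨⟨h1, h2, h3⟩, ho⟩ ⟨H', o'⟩ ⟨⟨h1', h2', h3'⟩, ho'⟩ h
    simp only [hf] at h h1 h1' h3 h3'
    have e1 : H = H' := by
      rw [← sup_seg_inf' hSR h1 (h3 ha) (h3 hb) o, h, sup_seg_inf' hSR h1' (h3' ha) (h3' hb) o']
    have e2 : o = o' := by
      apply seg_inj hR (Finset.mem_of_mem_erase ho) (Finset.mem_of_mem_erase ho')
      rw [← sup_seg_inf hSR h1 o, h, sup_seg_inf hSR h1' o']
    rw [e1, e2]
  have hdisj : Disjoint (cs S X) (f '' (cs S S.verts ×ˢ (O : Set (Option (ℕ × ℕ))))) := by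
    rw [Set.disjoint_left]
    rintro K ⟨hK, -, -⟩ ⟨⟨H, o⟩, ⟨⟨h1, h2, h3⟩, ho⟩, rfl⟩
    simp only [hf] at hK
    have ho' : o ∈ O := ho
    have h4 : seg R o ≤ ends G a b :=
      (le_inf (le_sup_right.trans hK) (seg_le R o)).trans hSR
    have h5 : o = some (0, R.length) := by
      apply seg_inj hR (Finset.mem_of_mem_erase ho') hz
      exact le_antisymm (h4.trans (ends_le_seg R _)) ((seg_zero R).trans (ends_le_seg R _))
    exact (Finset.ne_of_mem_erase ho') h5
  rw [← hOc, ← Set.ncard_coe_finset, ← Set.ncard_prod, ← hinj.ncard_image,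
    ← Set.ncard_union_eq hdisj (Set.toFinite _) (Set.toFinite _)]
  refine Set.ncard_le_ncard ?_ (Set.toFinite _)
  rintro K (⟨h1, h2, h3⟩ | ⟨⟨H, o⟩, ⟨⟨h1, h2, h3⟩, ho⟩, rfl⟩)
  · exact ⟨h1.trans le_sup_left, h2, h3⟩
  · refine ⟨sup_le_sup h1 (seg_le R o), seg_connected R h2 (h3 ha) (h3 hb) o, ?_⟩
    exact fun x hx => Or.inl (h3 (hX hx))

lemma theta_count [Finite V] {a b : V} {R₁ R₂ R₃ : G.Walk a b}
    (h₁ : R₁.IsPath) (h₂ : R₂.IsPath) (h₃ : R₃.IsPath)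
    (h12 : R₁.toSubgraph ⊓ R₂.toSubgraph ≤ ends G a b)
    (h3 : (R₁.toSubgraph ⊔ R₂.toSubgraph) ⊓ R₃.toSubgraph ≤ ends G a b)
    {X : Set V} (hX : X ⊆ (R₁.toSubgraph ⊔ R₂.toSubgraph ⊔ R₃.toSubgraph).verts) :
    1 + (brk X R₁).card + (brk X R₂).card + (brk X R₃).card
      + (brk X R₁).card * (brk X R₂).card + (brk X R₁).card * (brk X R₃).card
      + (brk X R₂).card * (brk X R₃).card
      ≤ (cs (R₁.toSubgraph ⊔ R₂.toSubgraph ⊔ R₃.toSubgraph) X).ncard := by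
  classical
  set P := (opts X R₁) ×ˢ (opts X R₂) ×ˢ (opts X R₃) with hP
  set Q := ((brk X R₁).image some) ×ˢ ((brk X R₂).image some) ×ˢ ((brk X R₃).image some) with hQ
  have hQP : Q ⊆ P := by
    apply Finset.product_subset_product (Finset.subset_insert _ _)
    exact Finset.product_subset_product (Finset.subset_insert _ _) (Finset.subset_insert _ _)
  have hcard : (P \ Q).card = 1 + (brk X R₁).card + (brk X R₂).card + (brk X R₃).card
      + (brk X R₁).card * (brk X R₂).card + (brk X R₁).card * (brk X R₃).card
      + (brk X R₂).card * (brk X R₃).card := by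
    rw [Finset.card_sdiff_of_subset hQP, hP, hQ]
    simp only [Finset.card_product, card_opts,
      Finset.card_image_of_injective _ (Option.some_injective _)]
    apply Nat.sub_eq_of_eq_add
    ring
  rw [← hcard, ← Set.ncard_coe_finset]
  refine Set.ncard_le_ncard_of_injOn
    (fun p => seg R₁ p.1 ⊔ seg R₂ p.2.1 ⊔ seg R₃ p.2.2) ?_ ?_ (Set.toFinite _)
  · rintro ⟨o₁, o₂, o₃⟩ hp
    simp only [Finset.coe_sdiff, Set.mem_sdiff, Finset.mem_coe, hP, hQ, Finset.mem_product] at hp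
    obtain ⟨⟨m1, m2, m3⟩, hn⟩ := hp
    refine ⟨sup_le_sup (sup_le_sup (seg_le _ _) (seg_le _ _)) (seg_le _ _), ?_, ?_⟩
    · have cases3 : o₁ = none ∨ o₂ = none ∨ o₃ = none := by
        by_contra hc
        push Not at hc
        apply hn
        simp only [opts, Finset.mem_insert] at m1 m2 m3
        exact ⟨m1.resolve_left hc.1, m2.resolve_left hc.2.1, m3.resolve_left hc.2.2⟩
      have full : ∀ R : G.Walk a b, (seg R none).Connected := fun R => R.toSubgraph_connected
      rcases cases3 with rfl | rfl | rfl
      · apply seg_connected _ (seg_connected _ (full _) (start_mem_seg _ _) (end_mem_seg _ _) _)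
        · exact Or.inl (start_mem_seg _ _)
        · exact Or.inl (end_mem_seg _ _)
      · rw [sup_comm (seg R₁ o₁)]
        apply seg_connected _ (seg_connected _ (full _) (start_mem_seg _ _) (end_mem_seg _ _) _)
        · exact Or.inl (start_mem_seg _ _)
        · exact Or.inl (end_mem_seg _ _)
      · have e : seg R₁ o₁ ⊔ seg R₂ o₂ ⊔ seg R₃ none = seg R₃ none ⊔ seg R₁ o₁ ⊔ seg R₂ o₂ := by
          rw [sup_comm, sup_assoc]
        simp only [e]
        apply seg_connected _ (seg_connected _ (full _) (start_mem_seg _ _) (end_mem_seg _ _) _)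
        · exact Or.inl (start_mem_seg _ _)
        · exact Or.inl (end_mem_seg _ _)
    · intro x hx
      rcases hX hx with (hx' | hx') | hx'
      · exact Or.inl (Or.inl (seg_verts m1 hx (by simpa using hx')))
      · exact Or.inl (Or.inr (seg_verts m2 hx (by simpa using hx')))
      · exact Or.inr (seg_verts m3 hx (by simpa using hx'))
  · rintro ⟨o₁, o₂, o₃⟩ hp ⟨o₁', o₂', o₃'⟩ hp' h
    simp only [Finset.coe_sdiff, Set.mem_sdiff, Finset.mem_coe, hP, hQ, Finset.mem_product] at hp hp'
    obtain ⟨⟨m1, m2, m3⟩, -⟩ := hp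
    obtain ⟨⟨m1', m2', m3'⟩, -⟩ := hp'
    simp only at h
    have ha : ∀ o₁ o₂, a ∈ (seg R₁ o₁ ⊔ seg R₂ o₂).verts := fun o₁ _ =>
      Or.inl (start_mem_seg _ _)
    have hb : ∀ o₁ o₂, b ∈ (seg R₁ o₁ ⊔ seg R₂ o₂).verts := fun o₁ _ =>
      Or.inl (end_mem_seg _ _)
    have hl : ∀ o₁ o₂, seg R₁ o₁ ⊔ seg R₂ o₂ ≤ R₁.toSubgraph ⊔ R₂.toSubgraph := fun o₁ o₂ =>
      sup_le_sup (seg_le _ _) (seg_le _ _)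
    have e3 : o₃ = o₃' := by
      apply seg_inj h₃ m3 m3'
      rw [← sup_seg_inf h3 (hl o₁ o₂) o₃, h, sup_seg_inf h3 (hl _ _)]
    have e12 : seg R₁ o₁ ⊔ seg R₂ o₂ = seg R₁ o₁' ⊔ seg R₂ o₂' := by
      rw [← sup_seg_inf' h3 (hl o₁ o₂) (ha _ _) (hb _ _) o₃, h,
        sup_seg_inf' h3 (hl _ _) (ha _ _) (hb _ _)]
    have e2 : o₂ = o₂' := by
      apply seg_inj h₂ m2 m2'
      rw [← sup_seg_inf h12 (seg_le R₁ o₁) o₂, e12, sup_seg_inf h12 (seg_le _ _)]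
    have e1 : o₁ = o₁' := by
      apply seg_inj h₁ m1 m1'
      rw [← sup_seg_inf' h12 (seg_le R₁ o₁) (start_mem_seg _ _) (end_mem_seg _ _) o₂, e12,
        sup_seg_inf' h12 (seg_le _ _) (start_mem_seg _ _) (end_mem_seg _ _)]
    rw [e1, e2, e3]

/-! ### cardinalities of options -/

/-- triangle of pairs -/
def tri (lo d : ℕ) : Finset (ℕ × ℕ) :=
  (Finset.range (d + 1)).biUnion (fun j => (Finset.range j).image (fun i => (lo + i, lo + j)))

lemma mem_tri {lo d : ℕ} {p : ℕ × ℕ} : p ∈ tri lo d ↔ lo ≤ p.1 ∧ p.1 < p.2 ∧ p.2 ≤ lo + d := by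
  rcases p with ⟨i, j⟩
  simp only [tri, Finset.mem_biUnion, Finset.mem_range, Finset.mem_image, Prod.mk.injEq]
  constructor
  · rintro ⟨j', h1, i', h2, rfl, rfl⟩
    omega
  · rintro ⟨h1, h2, h3⟩
    exact ⟨j - lo, by omega, i - lo, by omega, by omega, by omega⟩

lemma card_tri (lo d : ℕ) : 2 * (tri lo d).card = d * (d + 1) := by
  have h : (tri lo d).card = ∑ j ∈ Finset.range (d + 1), j := by
    rw [tri, Finset.card_biUnion]
    · refine Finset.sum_congr rfl fun j _ => ?_
      rw [Finset.card_image_of_injective, Finset.card_range]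
      intro x y h
      simpa using h
    · intro x _ y _ hxy
      simp only [Function.onFun]
      rw [Finset.disjoint_left]
      rintro ⟨i, j⟩ h1 h2
      simp only [Finset.mem_image, Finset.mem_range, Prod.mk.injEq] at h1 h2
      obtain ⟨_, _, _, h1⟩ := h1
      obtain ⟨_, _, _, h2⟩ := h2
      omega
  have := Finset.sum_range_id_mul_two (d + 1)
  rw [h, mul_comm, this]
  simp [mul_comm]

lemma card_brk {X : Set V} {a b : V} {R : G.Walk a b} (x d y : ℕ) (hL : x + d + y = R.length)
    (hk : ∀ k ≤ R.length, R.getVert k ∈ X → k = 0 ∨ k = x ∨ k = x + d ∨ k = R.length) :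
    x * (x + 1) + d * (d + 1) + y * (y + 1) ≤ 2 * (brk X R).card := by
  classical
  have hsub : tri 0 x ∪ (tri x d ∪ tri (x + d) y) ⊆ brk X R := by
    rintro ⟨i, j⟩ hp
    rw [mem_brk]
    simp only [Finset.mem_union, mem_tri] at hp
    refine ⟨by omega, by omega, fun k h1 h2 hX => ?_⟩
    have := hk k (by omega) hX
    omega
  have hc := Finset.card_le_card hsub
  rw [Finset.card_union_of_disjoint, Finset.card_union_of_disjoint] at hc
  · have h1 := card_tri 0 x
    have h2 := card_tri x d
    have h3 := card_tri (x + d) y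
    omega
  · rw [Finset.disjoint_left]
    rintro ⟨i, j⟩ h1 h2
    simp only [mem_tri] at h1 h2
    omega
  · rw [Finset.disjoint_left]
    rintro ⟨i, j⟩ h1 h2
    simp only [Finset.mem_union, mem_tri] at h1 h2
    omega

lemma card_brk_univ {a b : V} {R : G.Walk a b} (X : Set V) : R.length ≤ (brk X R).card := by
  classical
  have hsub : (Finset.range R.length).image (fun k => (k, k + 1)) ⊆ brk X R := by
    rintro ⟨i, j⟩ hp
    simp only [Finset.mem_image, Finset.mem_range, Prod.mk.injEq] at hp
    obtain ⟨k, hk, rfl, rfl⟩ := hp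
    rw [mem_brk]
    exact ⟨by omega, by omega, fun k h1 h2 => by omega⟩
  have hc := Finset.card_le_card hsub
  rwa [Finset.card_image_of_injective, Finset.card_range] at hc
  intro x y h
  simpa using h

lemma arith1 (x d y s t : ℤ) (hs : 1 ≤ s) (ht : 1 ≤ t) (hst : 3 ≤ s + t)
    (hx : 0 ≤ x) (hd : 0 ≤ d) (hy : 0 ≤ y) :
    2 * (x + d + y + s + t) * (x + d + y + s + t - 1) + 8 ≤
    4 + 2 * ((x * (x + 1) + d * (d + 1) + y * (y + 1)) + s * (s + 1) + t * (t + 1))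
      + (x * (x + 1) + d * (d + 1) + y * (y + 1)) * (s * (s + 1))
      + (x * (x + 1) + d * (d + 1) + y * (y + 1)) * (t * (t + 1))
      + (s * (s + 1)) * (t * (t + 1)) := by
  obtain ⟨L, hL⟩ : ∃ L, L = x + d + y := ⟨_, rfl⟩
  obtain ⟨q, hq⟩ : ∃ q, q = x * (x + 1) + d * (d + 1) + y * (y + 1) := ⟨_, rfl⟩
  obtain ⟨W, hW⟩ : ∃ W, W = 2 + s * (s + 1) + t * (t + 1) := ⟨_, rfl⟩
  have h1 : L ^ 2 + 3 * L ≤ 3 * q := by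
    rw [hL, hq]; nlinarith [sq_nonneg (x - d), sq_nonneg (x - y), sq_nonneg (d - y)]
  have hs2 : 0 ≤ (s - 1) * (s - 2) := by
    rcases eq_or_lt_of_le hs with h | h
    · rw [← h]; norm_num
    · exact mul_nonneg (by omega) (by omega)
  have ht2 : 0 ≤ (t - 1) * (t - 2) := by
    rcases eq_or_lt_of_le ht with h | h
    · rw [← h]; norm_num
    · exact mul_nonneg (by omega) (by omega)
  have hW2 : 4 * (s + t) - 2 ≤ W := by rw [hW]; nlinarith
  have hW1 : 6 ≤ W := by omega
  have hL0 : 0 ≤ L := by omega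
  have h2 : (L ^ 2 + 3 * L) * W ≤ 3 * q * W := mul_le_mul_of_nonneg_right h1 (by omega)
  have h3 : 6 * L ^ 2 ≤ L ^ 2 * W := by nlinarith [sq_nonneg L]
  have h4 : L * (4 * (s + t) - 2) ≤ L * W := mul_le_mul_of_nonneg_left hW2 hL0
  have h5 : 0 ≤ s * t * ((s + 1) * (t + 1) - 4) := by
    apply mul_nonneg (by positivity)
    nlinarith
  have h6 : 2 * (s + t) * (s + t - 1) + 8 ≤ (s * (s + 1) + 2) * (t * (t + 1) + 2) := by
    nlinarith
  have h7 : 2 * (L + (s + t)) * (L + (s + t) - 1) + 8 ≤ q * W +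
      (s * (s + 1) + 2) * (t * (t + 1) + 2) := by nlinarith
  have e1 : x + d + y + s + t = L + (s + t) := by rw [hL]; ring
  rw [e1, ← hq]
  refine h7.trans (le_of_eq ?_)
  rw [hW]; ring

lemma arith2 (x x' y y' t : ℤ) (hx : 1 ≤ x) (hx' : 1 ≤ x') (hy : 1 ≤ y) (hy' : 1 ≤ y')
    (ht : 1 ≤ t) :
    2 * (x + x' + y + y' + t) * (x + x' + y + y' + t - 1) + 8 ≤
    4 + 2 * ((x * (x + 1) + x' * (x' + 1)) + (y * (y + 1) + y' * (y' + 1)) + t * (t + 1))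
      + (x * (x + 1) + x' * (x' + 1)) * (y * (y + 1) + y' * (y' + 1))
      + (x * (x + 1) + x' * (x' + 1)) * (t * (t + 1))
      + (y * (y + 1) + y' * (y' + 1)) * (t * (t + 1)) := by
  have key1 : ∀ l : ℤ, 1 ≤ l → 4 * (l * t) + 2 * (l * (l - 1)) ≤ l * (l + 1) * (t * (t + 1)) := by
    intro l hl
    obtain ⟨r, hr, rfl⟩ : ∃ r : ℤ, 0 ≤ r ∧ t = 1 + r := ⟨t - 1, by omega, by ring⟩
    obtain ⟨k, hk, rfl⟩ : ∃ r : ℤ, 0 ≤ r ∧ l = 1 + r := ⟨l - 1, by omega, by ring⟩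
    have : (0:ℤ) ≤ k * r + k ^ 2 * r + k * r ^ 2 + k ^ 2 * r ^ 2 + r + r ^ 2 := by positivity
    have h2 : (0:ℤ) ≤ k * r := by positivity
    have h3 : (0:ℤ) ≤ k ^ 2 * r := by positivity
    have h4 : (0:ℤ) ≤ k * r ^ 2 := by positivity
    have h5 : (0:ℤ) ≤ k ^ 2 * r ^ 2 := by positivity
    have h6 : (0:ℤ) ≤ r ^ 2 := by positivity
    nlinarith
  have key2 : ∀ l m : ℤ, 1 ≤ l → 1 ≤ m → 4 * (l * m) ≤ l * (l + 1) * (m * (m + 1)) := by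
    intro l m hl hm
    have : 0 ≤ l * m * ((l + 1) * (m + 1) - 4) := by
      apply mul_nonneg (by positivity)
      nlinarith
    nlinarith
  have a1 := key1 x hx
  have a2 := key1 x' hx'
  have a3 := key1 y hy
  have a4 := key1 y' hy'
  have b1 := key2 x y hx hy
  have b2 := key2 x y' hx hy'
  have b3 := key2 x' y hx' hy
  have b4 := key2 x' y' hx' hy'
  nlinarith [sq_nonneg (x - x'), sq_nonneg (y - y')]

lemma count_mono (A B C qa qb qc F m : ℕ) (hA : qa ≤ 2 * A) (hB : qb ≤ 2 * B) (hC : qc ≤ 2 * C)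
    (hF : 1 + A + B + C + A * B + A * C + B * C ≤ F)
    (h : 2 * (m : ℤ) * (m - 1) + 8 ≤ 4 + 2 * (qa + qb + qc) + qa * qb + qa * qc + qb * qc) :
    (m : ℤ) * (m - 1) + 4 ≤ 2 * F := by
  have h1 : qa * qb ≤ 2 * A * (2 * B) := Nat.mul_le_mul hA hB
  have h2 : qa * qc ≤ 2 * A * (2 * C) := Nat.mul_le_mul hA hC
  have h3 : qb * qc ≤ 2 * B * (2 * C) := Nat.mul_le_mul hB hC
  zify at *
  nlinarith

/-- Three internally disjoint `a`-`b` paths. -/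
structure Theta {a b : V} (R₁ R₂ R₃ : G.Walk a b) : Prop where
  p₁ : R₁.IsPath
  p₂ : R₂.IsPath
  p₃ : R₃.IsPath
  h12 : R₁.toSubgraph ⊓ R₂.toSubgraph ≤ ends G a b
  h3 : (R₁.toSubgraph ⊔ R₂.toSubgraph) ⊓ R₃.toSubgraph ≤ ends G a b
  ne : a ≠ b

lemma Theta.swap {a b : V} {R₁ R₂ R₃ : G.Walk a b} (h : Theta R₁ R₂ R₃) : Theta R₂ R₁ R₃ :=
  ⟨h.p₂, h.p₁, h.p₃, by rw [inf_comm]; exact h.h12, by rw [sup_comm]; exact h.h3, h.ne⟩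

lemma length_pos' {a b : V} (h : a ≠ b) (R : G.Walk a b) : 1 ≤ R.length := by
  rw [Nat.one_le_iff_ne_zero]
  intro h0
  exact h (Walk.eq_of_length_eq_zero h0)

lemma mem_ends {a b x : V} : x ∈ (ends G a b).verts ↔ x = a ∨ x = b := by
  simp [ends, or_comm]

lemma two_paths_len {a b : V} {R R' : G.Walk a b} (h : R.toSubgraph ⊓ R'.toSubgraph ≤ ends G a b)
    (hab : a ≠ b) : 3 ≤ R.length + R'.length := by
  have h1 := length_pos' hab R
  have h2 := length_pos' hab R'
  by_contra hc
  have e1 : R.length = 1 := by omega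
  have e2 : R'.length = 1 := by omega
  have key : ∀ W : G.Walk a b, W.length = 1 → W.toSubgraph.Adj a b := by
    intro W hW
    have := W.toSubgraph_adj_getVert (i := 0) (by omega)
    have e : W.getVert (0 + 1) = b := by
      have := W.getVert_length
      rwa [hW] at this
    rwa [e, Walk.getVert_zero] at this
  have := h.2 (show (R.toSubgraph ⊓ R'.toSubgraph).Adj a b from ⟨key R e1, key R' e2⟩)
  simp [ends] at this

lemma end_pos {a b : V} {R : G.Walk a b} (hR : R.IsPath) {k : ℕ} (hk : k ≤ R.length)
    (h : R.getVert k = a ∨ R.getVert k = b) : k = 0 ∨ k = R.length := by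
  have inj := hR.getVert_injOn
  rcases h with h | h
  · left
    exact inj (by simpa using hk) (by simp) (by simpa using h)
  · right
    exact inj (by simpa using hk) (by simp) (by simpa using h)

lemma Theta.e3 {a b : V} {R₁ R₂ R₃ : G.Walk a b} (h : Theta R₁ R₂ R₃) {x : V}
    (h1 : x ∈ R₁.support) (h3 : x ∈ R₃.support) : x = a ∨ x = b := by
  rw [← mem_ends (G := G)]
  exact h.h3.1 ⟨Or.inl (by simpa using h1), by simpa using h3⟩

lemma Theta.e2 {a b : V} {R₁ R₂ R₃ : G.Walk a b} (h : Theta R₁ R₂ R₃) {x : V}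
    (h1 : x ∈ R₁.support) (h3 : x ∈ R₂.support) : x = a ∨ x = b := by
  rw [← mem_ends (G := G)]
  exact h.h12.1 ⟨by simpa using h1, by simpa using h3⟩

lemma theta_same [Finite V] {a b : V} {R₁ R₂ R₃ : G.Walk a b} (h : Theta R₁ R₂ R₃) {u v : V}
    (hu : u ∈ R₁.support) (hv : v ∈ R₁.support) (m : ℕ)
    (hm : m = R₁.length + R₂.length + R₃.length) :
    (m : ℤ) * (m - 1) + 4 ≤
      2 * (cs (R₁.toSubgraph ⊔ R₂.toSubgraph ⊔ R₃.toSubgraph) {u, v}).ncard := by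
  have hF := theta_count h.p₁ h.p₂ h.p₃ h.h12 h.h3 (X := {u, v}) (by
    rintro x (rfl | rfl)
    · exact Or.inl (Or.inl (by simpa using hu))
    · exact Or.inl (Or.inl (by simpa using hv)))
  have g2 : ∀ k ≤ R₂.length, R₂.getVert k ∈ ({u, v} : Set V) → k = 0 ∨ k = R₂.length := by
    intro k hk hX
    apply end_pos h.p₂ hk
    refine h.e2 ?_ (R₂.getVert_mem_support k)
    rcases hX with e | e <;> rw [e] <;> assumption
  have g3 : ∀ k ≤ R₃.length, R₃.getVert k ∈ ({u, v} : Set V) → k = 0 ∨ k = R₃.length := by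
    intro k hk hX
    apply end_pos h.p₃ hk
    refine h.e3 ?_ (R₃.getVert_mem_support k)
    rcases hX with e | e <;> rw [e] <;> assumption
  have B2 := card_brk (X := {u, v}) (R := R₂) 0 R₂.length 0 (by simp) (fun k hk hX => by
    have := g2 k hk hX; omega)
  have B3 := card_brk (X := {u, v}) (R := R₃) 0 R₃.length 0 (by simp) (fun k hk hX => by
    have := g3 k hk hX; omega)
  rw [Walk.mem_support_iff_exists_getVert] at hu hv
  obtain ⟨i, hi, hil⟩ := hu
  obtain ⟨j, hj, hjl⟩ := hv
  have inj := h.p₁.getVert_injOn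
  have B1 : ∃ x d y, x + d + y = R₁.length ∧
      x * (x + 1) + d * (d + 1) + y * (y + 1) ≤ 2 * (brk {u, v} R₁).card := by
    have pos : ∀ k ≤ R₁.length, R₁.getVert k ∈ ({u, v} : Set V) → k = i ∨ k = j := by
      rintro k hk (e | e)
      · left
        exact inj hk hil (e.trans hi.symm)
      · right
        exact inj hk hjl (e.trans hj.symm)
    rcases le_total i j with hij | hij
    · refine ⟨i, j - i, R₁.length - j, by omega, card_brk _ _ _ (by omega) ?_⟩
      intro k hk hX
      have := pos k hk hX
      omega
    · refine ⟨j, i - j, R₁.length - i, by omega, card_brk _ _ _ (by omega) ?_⟩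
      intro k hk hX
      have := pos k hk hX
      omega
  obtain ⟨x, d, y, hL, B1⟩ := B1
  refine count_mono _ _ _ _ _ _ _ m B1 B2 B3 hF ?_
  have hs := length_pos' h.ne R₂
  have ht := length_pos' h.ne R₃
  have hst : 3 ≤ R₂.length + R₃.length :=
    two_paths_len ((inf_le_inf_right _ le_sup_right).trans h.h3) h.ne
  have := arith1 x d y R₂.length R₃.length (by exact_mod_cast hs) (by exact_mod_cast ht)
    (by exact_mod_cast hst) (by positivity) (by positivity) (by positivity)
  rw [hm, ← hL]
  push_cast
  refine this.trans (le_of_eq ?_)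
  ring

lemma theta_diff [Finite V] {a b : V} {R₁ R₂ R₃ : G.Walk a b} (h : Theta R₁ R₂ R₃) {u v : V}
    (hu : u ∈ R₁.support) (hv : v ∈ R₂.support) (hu' : u ∉ R₂.support) (hv' : v ∉ R₁.support)
    (m : ℕ)
    (hm : m = R₁.length + R₂.length + R₃.length) :
    (m : ℤ) * (m - 1) + 4 ≤
      2 * (cs (R₁.toSubgraph ⊔ R₂.toSubgraph ⊔ R₃.toSubgraph) {u, v}).ncard := by
  have hF := theta_count h.p₁ h.p₂ h.p₃ h.h12 h.h3 (X := {u, v}) (by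
    rintro x (rfl | rfl)
    · exact Or.inl (Or.inl (by simpa using hu))
    · exact Or.inl (Or.inr (by simpa using hv)))
  have g3 : ∀ k ≤ R₃.length, R₃.getVert k ∈ ({u, v} : Set V) → k = 0 ∨ k = R₃.length := by
    intro k hk hX
    apply end_pos h.p₃ hk
    rcases hX with e | e
    · exact h.e3 (by rw [e]; exact hu) (R₃.getVert_mem_support k)
    · exact h.swap.e3 (by rw [e]; exact hv) (R₃.getVert_mem_support k)
  have B3 := card_brk (X := {u, v}) (R := R₃) 0 R₃.length 0 (by simp) (fun k hk hX => by
    have := g3 k hk hX; omega)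
  have gen : ∀ (R : G.Walk a b) (p q : V), R.IsPath → p ∈ R.support → q ∉ R.support → p ≠ a →
      p ≠ b → ({u, v} : Set V) = {p, q} → ∃ x y, 1 ≤ x ∧ 1 ≤ y ∧ x + y = R.length ∧
        x * (x + 1) + y * (y + 1) ≤ 2 * (brk {u, v} R).card := by
    intro R p q hR hp hq hpa hpb hpq
    rw [Walk.mem_support_iff_exists_getVert] at hp
    obtain ⟨i, hi, hil⟩ := hp
    have hi0 : i ≠ 0 := by
      rintro rfl
      exact hpa (by rw [← hi, Walk.getVert_zero])
    have hiL : i ≠ R.length := by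
      rintro rfl
      exact hpb (by rw [← hi, Walk.getVert_length])
    refine ⟨i, R.length - i, by omega, by omega, by omega, ?_⟩
    have := card_brk (X := {u, v}) (R := R) i 0 (R.length - i) (by omega) (fun k hk hX => by
      rw [hpq] at hX
      rcases hX with e | e
      · have := hR.getVert_injOn hk hil (e.trans hi.symm)
        omega
      · exact absurd (e ▸ R.getVert_mem_support k) hq)
    omega
  have ua : u ≠ a := fun e => hu' (e ▸ R₂.start_mem_support)
  have ub : u ≠ b := fun e => hu' (e ▸ R₂.end_mem_support)
  have va : v ≠ a := fun e => hv' (e ▸ R₁.start_mem_support)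
  have vb : v ≠ b := fun e => hv' (e ▸ R₁.end_mem_support)
  obtain ⟨x, x', hx, hx', hL, B1⟩ := gen R₁ u v h.p₁ hu hv' ua ub rfl
  obtain ⟨y, y', hy, hy', hL', B2⟩ := gen R₂ v u h.p₂ hv hu' va vb (Set.pair_comm _ _)
  refine count_mono _ _ _ _ _ _ _ m B1 B2 B3 hF ?_
  have ht := length_pos' h.ne R₃
  have := arith2 x x' y y' R₃.length (by exact_mod_cast hx) (by exact_mod_cast hx')
    (by exact_mod_cast hy) (by exact_mod_cast hy') (by exact_mod_cast ht)
  rw [hm, ← hL, ← hL']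
  push_cast
  refine le_trans (le_of_eq ?_) (this.trans (le_of_eq ?_))
  · ring
  · ring

lemma theta_pair [Finite V] {a b : V} {R₁ R₂ R₃ : G.Walk a b} (h : Theta R₁ R₂ R₃) {u v : V}
    (hu : u ∈ R₁.support ∨ u ∈ R₂.support) (hv : v ∈ R₁.support ∨ v ∈ R₂.support)
    (m : ℕ)
    (hm : m = R₁.length + R₂.length + R₃.length) :
    (m : ℤ) * (m - 1) + 4 ≤
      2 * (cs (R₁.toSubgraph ⊔ R₂.toSubgraph ⊔ R₃.toSubgraph) {u, v}).ncard := by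
  by_cases h1 : u ∈ R₁.support ∧ v ∈ R₁.support
  · exact theta_same h h1.1 h1.2 m hm
  by_cases h2 : u ∈ R₂.support ∧ v ∈ R₂.support
  · have := theta_same h.swap h2.1 h2.2 m (by omega)
    rwa [sup_comm R₂.toSubgraph] at this
  by_cases hu1 : u ∈ R₁.support
  · exact theta_diff h hu1 (by tauto) (by tauto) (by tauto) m hm
  · have := theta_diff h.swap (u := u) (v := v) (by tauto) (by tauto) (by tauto) (by tauto) m
      (by omega)
    rwa [sup_comm R₂.toSubgraph] at this

lemma theta_span [Finite V] {a b : V} {R₁ R₂ R₃ : G.Walk a b} (h : Theta R₁ R₂ R₃) :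
    R₁.length + R₂.length + R₃.length + 1 ≤
      (cs (R₁.toSubgraph ⊔ R₂.toSubgraph ⊔ R₃.toSubgraph)
        (R₁.toSubgraph ⊔ R₂.toSubgraph ⊔ R₃.toSubgraph).verts).ncard := by
  refine le_trans ?_ (theta_count h.p₁ h.p₂ h.p₃ h.h12 h.h3 le_rfl)
  have h1 := card_brk_univ (R := R₁) (R₁.toSubgraph ⊔ R₂.toSubgraph ⊔ R₃.toSubgraph).verts
  have h2 := card_brk_univ (R := R₂) (R₁.toSubgraph ⊔ R₂.toSubgraph ⊔ R₃.toSubgraph).verts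
  have h3 := card_brk_univ (R := R₃) (R₁.toSubgraph ⊔ R₂.toSubgraph ⊔ R₃.toSubgraph).verts
  generalize (brk _ R₁).card = A at *
  generalize (brk _ R₂).card = B at *
  generalize (brk _ R₃).card = C at *
  have := Nat.zero_le (A * B)
  have := Nat.zero_le (A * C)
  have := Nat.zero_le (B * C)
  omega

/-! ### Ears -/

lemma first_hit (S : Set V) {c s : V} (w : G.Walk c s) (hs : s ∈ S) :
    ∃ b ∈ S, ∃ R : G.Walk c b, R.IsPath ∧ (∀ x ∈ R.support, x ∈ w.support) ∧
      ∀ x ∈ R.support, x ∈ S → x = b := by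
  classical
  induction w with
  | nil => exact ⟨_, hs, Walk.nil, by simp, by simp, by simp⟩
  | @cons c d s h p ih =>
    by_cases hc : c ∈ S
    · exact ⟨c, hc, Walk.nil, by simp, by simp, by simp⟩
    · obtain ⟨b, hb, R, hR, hsub, hS⟩ := ih hs
      refine ⟨b, hb, (Walk.cons h R).bypass, Walk.bypass_isPath _, ?_, ?_⟩
      · intro x hx
        have := Walk.support_bypass_subset_support _ hx
        simp only [Walk.support_cons, List.mem_cons] at this ⊢
        exact this.imp id (hsub x)
      · intro x hx hxS
        have := Walk.support_bypass_subset_support _ hx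
        simp only [Walk.support_cons, List.mem_cons] at this
        rcases this with rfl | h'
        · exact absurd hxS hc
        · exact hS x h' hxS

lemma avoid (h2 : TwoConnected G) {a c s : V} (hc : c ≠ a) (hs : s ≠ a) :
    ∃ w : G.Walk c s, a ∉ w.support := by
  have h := h2.2.2 a
  rw [IsCutVertex, not_not] at h
  obtain ⟨w⟩ := h.preconnected ⟨c, hc⟩ ⟨s, hs⟩
  refine ⟨w.map (Embedding.induce {u | u ≠ a}).toHom, ?_⟩
  intro hm
  have hm' := (Walk.support_map (Embedding.induce {u | u ≠ a}).toHom w) ▸ hm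
  obtain ⟨⟨x, hx⟩, _, hxa⟩ := List.mem_map.1 hm'
  exact hx hxa

lemma fan (h2 : TwoConnected G) {S : Set V} {a s c : V} (hs : s ∈ S) (hsa : s ≠ a)
    (hca : c ≠ a) :
    ∃ b ∈ S, b ≠ a ∧ ∃ R : G.Walk c b, R.IsPath ∧ a ∉ R.support ∧
      ∀ x ∈ R.support, x ∈ S → x = b := by
  obtain ⟨w, hw⟩ := avoid h2 hca hsa
  obtain ⟨b, hb, R, hR, hsub, hS⟩ := first_hit S w hs
  refine ⟨b, hb, ?_, R, hR, fun h => hw (hsub _ h), hS⟩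
  rintro rfl
  exact hw (hsub _ R.end_mem_support)

lemma ear_at (h2 : TwoConnected G) {S : G.Subgraph} {a s c : V} (ha : a ∈ S.verts)
    (hs : s ∈ S.verts) (hsa : s ≠ a) (hc : c ∉ S.verts) (hac : G.Adj a c) :
    ∃ b ∈ S.verts, a ≠ b ∧ ∃ R : G.Walk c b, (Walk.cons hac R).IsPath ∧ 1 ≤ R.length ∧
      S ⊓ (Walk.cons hac R).toSubgraph ≤ ends G a b := by
  obtain ⟨b, hb, hba, R, hR, haR, hS⟩ := fan h2 hs hsa hac.ne'
  have hcb : c ≠ b := fun h => hc (h ▸ hb)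
  have hv : ∀ x, x ∈ S.verts → x ∈ (Walk.cons hac R).support → x = a ∨ x = b := by
    intro x hx hx'
    rw [Walk.support_cons, List.mem_cons] at hx'
    exact hx'.imp id fun h => hS x h hx
  have hne : s(a, b) ∉ (Walk.cons hac R).edges := by
    rw [Walk.edges_cons, List.mem_cons]
    rintro (h | h)
    · rw [Sym2.eq_iff] at h
      rcases h with ⟨_, h⟩ | ⟨h, h'⟩
      · exact hcb h.symm
      · exact hba h'
    · exact haR (Walk.fst_mem_support_of_mem_edges _ h)
  refine ⟨b, hb, hba.symm, R, (Walk.cons_isPath_iff _ _).2 ⟨hR, haR⟩, length_pos' hcb R, ?_, ?_⟩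
  · rintro x ⟨hx, hx'⟩
    rw [mem_ends]
    exact hv x hx ((Walk.mem_verts_toSubgraph _).1 hx')
  · rintro x y ⟨hxy, hxy'⟩
    exfalso
    rw [Walk.adj_toSubgraph_iff_mem_edges] at hxy'
    have h1 := hv x hxy.fst_mem (Walk.fst_mem_support_of_mem_edges _ hxy')
    have h2 := hv y hxy.snd_mem (Walk.snd_mem_support_of_mem_edges _ hxy')
    rcases h1 with rfl | rfl <;> rcases h2 with rfl | rfl
    · exact hxy.ne rfl
    · exact hne hxy'
    · exact hne (Sym2.eq_swap ▸ hxy')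
    · exact hxy.ne rfl

lemma boundary (hG : G.Connected) {S : Set V} {s t : V} (hs : s ∈ S) (ht : t ∉ S) :
    ∃ a ∈ S, ∃ c, c ∉ S ∧ G.Adj a c := by
  obtain ⟨w⟩ := hG.preconnected s t
  obtain ⟨d, _, h1, h2⟩ := w.exists_boundary_dart S hs ht
  exact ⟨d.fst, h1, d.snd, h2, d.adj⟩

lemma exists_ear (h2 : TwoConnected G) {S : G.Subgraph} {s s' t : V} (hs : s ∈ S.verts)
    (hs' : s' ∈ S.verts) (hss : s ≠ s') (ht : t ∉ S.verts) :
    ∃ a ∈ S.verts, ∃ b ∈ S.verts, a ≠ b ∧ ∃ R : G.Walk a b, R.IsPath ∧ 2 ≤ R.length ∧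
      S ⊓ R.toSubgraph ≤ ends G a b := by
  obtain ⟨a, ha, c, hc, hac⟩ := boundary h2.1 hs ht
  have : ∃ s'' ∈ S.verts, s'' ≠ a := by
    by_cases h : s = a
    · exact ⟨s', hs', fun h' => hss (h.trans h'.symm)⟩
    · exact ⟨s, hs, h⟩
  obtain ⟨s'', hs'', hne⟩ := this
  obtain ⟨b, hb, hab, R, hR, hl, hi⟩ := ear_at h2 ha hs'' hne hc hac
  exact ⟨a, ha, b, hb, hab, _, hR, by rw [Walk.length_cons]; omega, hi⟩

lemma ncard_sup_le [Finite V] {S : G.Subgraph} {a b : V} (R : G.Walk a b) (ha : a ∈ S.verts)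
    (hb : b ∈ S.verts) (hab : a ≠ b) :
    (S ⊔ R.toSubgraph).verts.ncard + 1 ≤ S.verts.ncard + R.length := by
  classical
  have h1 : (S ⊔ R.toSubgraph).verts ⊆
      S.verts ∪ (((Finset.Ico 1 R.length).image R.getVert : Finset V) : Set V) := by
    rintro x (hx | hx)
    · exact Or.inl hx
    · rw [Walk.mem_verts_toSubgraph, Walk.mem_support_iff_exists_getVert] at hx
      obtain ⟨k, rfl, hk⟩ := hx
      rcases Nat.eq_zero_or_pos k with rfl | h0
      · left; simpa using ha
      rcases hk.eq_or_lt with rfl | hk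
      · left; simpa using hb
      · right
        rw [Finset.mem_coe]
        exact Finset.mem_image_of_mem _ (Finset.mem_Ico.2 ⟨h0, hk⟩)
  have h2 := Set.ncard_le_ncard h1 (Set.toFinite _)
  have h3 := Set.ncard_union_le S.verts (((Finset.Ico 1 R.length).image R.getVert : Finset V) : Set V)
  rw [Set.ncard_coe_finset] at h3
  have h4 := Finset.card_image_le (s := Finset.Ico 1 R.length) (f := R.getVert)
  rw [Nat.card_Ico] at h4
  have h5 := length_pos' hab R
  omega

lemma cs_mono [Finite V] {S S' : G.Subgraph} {X X' : Set V} (hS : S ≤ S') (hX : X' ⊆ X) :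
    (cs S X).ncard ≤ (cs S' X').ncard :=
  Set.ncard_le_ncard (fun _ h => ⟨h.1.trans hS, h.2.1, hX.trans h.2.2⟩) (Set.toFinite _)

/-- Growth. -/
lemma grow [Finite V] (h2 : TwoConnected G) {u v : V} (huv : u ≠ v) (d : ℕ) :
    ∀ (S : G.Subgraph) (N : ℕ), S.vertsᶜ.ncard ≤ d → u ∈ S.verts → v ∈ S.verts →
      S.verts.ncard ≤ N → N * (N + 1) + 4 ≤ 2 * (cs S {u, v}).ncard →
      N + 1 ≤ (cs S S.verts).ncard →
      Nat.card V * (Nat.card V + 1) + 4 ≤ 2 * (cs (⊤ : G.Subgraph) {u, v}).ncard := by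
  induction d with
  | zero =>
    intro S N hd hu hv hN hF _
    have h0 : S.vertsᶜ = ∅ := (Set.ncard_eq_zero (Set.toFinite _)).1 (by omega)
    have h1 : S.verts = Set.univ := Set.compl_empty_iff.1 h0
    rw [h1, Set.ncard_univ] at hN
    have := cs_mono (X := {u, v}) (X' := {u, v}) (le_top : S ≤ ⊤) le_rfl
    nlinarith
  | succ d ih =>
    intro S N hd hu hv hN hF hs
    by_cases h1 : S.verts = Set.univ
    · refine ih S N ?_ hu hv hN hF hs
      simp [h1]
    obtain ⟨t, ht⟩ := (Set.ne_univ_iff_exists_notMem _).1 h1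
    obtain ⟨a, ha, b, hb, hab, R, hR, hl, hi⟩ := exists_ear h2 hu hv huv ht
    have hX : ({u, v} : Set V) ⊆ S.verts := by
      rintro x (rfl | rfl) <;> assumption
    have e1 := ear_pair hR hab ha hb hi hX
    have e2 := ear_span hR ha hb hi
    rw [card_opts] at e2
    have e3 := card_brk_univ (R := R) Set.univ
    have e4 := card_brk (R := R) (X := ∅) 0 R.length 0 (by simp) (by simp)
    have e5 := ncard_sup_le R ha hb hab
    refine ih (S ⊔ R.toSubgraph) (N + R.length - 1) ?_ (Or.inl hu) (Or.inl hv) (by omega) ?_ ?_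
    · have : (S ⊔ R.toSubgraph).vertsᶜ ⊂ S.vertsᶜ := by
        refine ⟨Set.compl_subset_compl.2 fun x hx => Or.inl hx, ?_⟩
        intro hsub'
        have hsub := Set.compl_subset_compl.1 hsub'
        have hm : R.getVert 1 ∈ S.verts := hsub (Or.inr (by simp))
        have : R.getVert 1 ∈ (ends G a b).verts := hi.1 ⟨hm, by simp⟩
        rw [mem_ends] at this
        have := end_pos hR (by omega) this
        omega
      have := Set.ncard_lt_ncard this (Set.toFinite _)
      omega
    · obtain ⟨t, ht⟩ : ∃ t, R.length = t + 2 := ⟨R.length - 2, by omega⟩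
      rw [ht] at e4 ⊢
      have : N + (t + 2) - 1 = N + t + 1 := by omega
      rw [this]
      have e6 : (N + 1) * ((t + 2) * (t + 2 + 1)) ≤
        (cs S S.verts).ncard * (2 * (brk ∅ R).card) := Nat.mul_le_mul hs (by omega)
      have e7 : (N + 1) * ((t + 2) * (t + 2 + 1)) + N * (N + 1) = (N + t + 1) * (N + t + 1 + 1) +
        (N * t * t + 3 * (N * t) + 4 * N + 2 * t + 4) := by ring
      have e8 : (cs S S.verts).ncard * (2 * (brk ∅ R).card) =
        2 * ((cs S S.verts).ncard * (brk ∅ R).card) := by ring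
      omega
    · have e6 : (N + 1) * (R.length + 1) ≤
        (cs S S.verts).ncard * ((brk Set.univ R).card + 1) := Nat.mul_le_mul hs (by omega)
      have : (N + 1) * (R.length + 1) = N * R.length + N + R.length + 1 := by ring
      have := Nat.zero_le (N * R.length)
      omega

/-! ### Cycles -/

lemma ncard_le_two' (a b : V) : ({a, b} : Set V).ncard ≤ 2 := by
  have := Set.ncard_insert_le a {b}
  rwa [Set.ncard_singleton] at this

lemma append_isPath {a b c : V} {p : G.Walk a b} {q : G.Walk b c} (hp : p.IsPath) (hq : q.IsPath)
    (h : ∀ x ∈ p.support, x ∈ q.support → x = b) : (p.append q).IsPath := by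
  rw [Walk.isPath_def, Walk.support_append, List.nodup_append']
  refine ⟨hp.support_nodup, hq.support_nodup.tail, ?_⟩
  intro x hx hx'
  have := h x hx (List.mem_of_mem_tail hx')
  subst this
  have h3 := hq.support_nodup
  rw [← Walk.cons_tail_support, List.nodup_cons] at h3
  exact h3.1 hx'

lemma arcs {w a b : V} {c : G.Walk w w} (hc : c.IsCycle) (ha : a ∈ c.support)
    (hb : b ∈ c.support) (hab : a ≠ b) :
    ∃ p q : G.Walk a b, p.IsPath ∧ q.IsPath ∧ p.toSubgraph ⊓ q.toSubgraph ≤ ends G a b ∧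
      p.toSubgraph ⊔ q.toSubgraph = c.toSubgraph := by
  classical
  have key : ∃ (p : G.Walk a b) (q : G.Walk b a), (p.append q).IsCycle ∧
      p.toSubgraph ⊔ q.toSubgraph = c.toSubgraph := by
    have hb' : b ∈ (c.rotate a ha).support := by
      rw [← Walk.mem_verts_toSubgraph, Walk.toSubgraph_rotate, Walk.mem_verts_toSubgraph]
      exact hb
    refine ⟨(c.rotate a ha).takeUntil b hb', (c.rotate a ha).dropUntil b hb', ?_, ?_⟩
    · rw [Walk.take_spec]; exact hc.rotate ha
    · rw [← Walk.toSubgraph_append, Walk.take_spec, Walk.toSubgraph_rotate]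
  obtain ⟨p, q, hpq, hs⟩ := key
  have hp : ¬ p.Nil := fun h => hab h.eq
  have hq : ¬ q.Nil := fun h => hab h.eq.symm
  have hnd := hpq.support_nodup
  rw [Walk.tail_support_append, List.nodup_append'] at hnd
  refine ⟨p, q.reverse, hpq.isPath_of_append_left hq,
    (hpq.isPath_of_append_right hp).reverse, ⟨?_, ?_⟩, by simpa using hs⟩
  · rintro x ⟨hx, hx'⟩
    rw [Walk.toSubgraph_reverse] at hx'
    rw [Walk.mem_verts_toSubgraph, ← Walk.cons_tail_support, List.mem_cons] at hx hx'
    rw [mem_ends]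
    rcases hx with h | h
    · exact Or.inl h
    rcases hx' with h' | h'
    · exact Or.inr h'
    exact absurd h' (hnd.2.2 h)
  · rintro x y ⟨hx, hx'⟩
    exfalso
    rw [Walk.toSubgraph_reverse] at hx'
    rw [Walk.adj_toSubgraph_iff_mem_edges] at hx hx'
    have := hpq.edges_nodup
    rw [Walk.edges_append, List.nodup_append'] at this
    exact this.2.2 hx hx'

/-- lying on a common cycle -/
def OnCyc (G : SimpleGraph V) (u v : V) : Prop :=
  ∃ (w : V) (c : G.Walk w w), c.IsCycle ∧ u ∈ c.support ∧ v ∈ c.support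

lemma onCyc_adj [Finite V] (h2 : TwoConnected G) {u x : V} (h : G.Adj u x) : OnCyc G u x := by
  have : ∃ t, t ∉ (G.subgraphOfAdj h).verts := by
    by_contra hc
    push Not at hc
    have h1 : (G.subgraphOfAdj h).verts = Set.univ := Set.eq_univ_of_forall hc
    have h3 := h2.2.1
    rw [← Set.ncard_univ, ← h1, subgraphOfAdj_verts] at h3
    have := ncard_le_two' u x
    omega
  obtain ⟨t, ht⟩ := this
  obtain ⟨a, ha, b, hb, hab, R, hR, hl, hi⟩ := exists_ear h2 (S := G.subgraphOfAdj h) (s := u)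
    (s' := x) (by simp) (by simp) h.ne ht
  have hS : (G.subgraphOfAdj h).Adj b a := by
    simp only [subgraphOfAdj_verts, Set.mem_insert_iff, Set.mem_singleton_iff] at ha hb
    rcases ha with rfl | rfl <;> rcases hb with rfl | rfl <;> simp_all [Sym2.eq_swap]
  have hax : (u = a ∧ x = b) ∨ (u = b ∧ x = a) := by
    simp only [subgraphOfAdj_verts, Set.mem_insert_iff, Set.mem_singleton_iff] at ha hb
    grind
  refine ⟨b, Walk.cons hS.adj_sub R, ?_, ?_, ?_⟩
  · rw [Walk.cons_isCycle_iff]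
    refine ⟨hR, fun he => ?_⟩
    have : (ends G a b).Adj b a := hi.2 ⟨hS, Walk.adj_toSubgraph_iff_mem_edges.2 he⟩
    simp [ends] at this
  · rcases hax with ⟨rfl, rfl⟩ | ⟨rfl, rfl⟩ <;> simp
  · rcases hax with ⟨rfl, rfl⟩ | ⟨rfl, rfl⟩ <;> simp

lemma onCyc_step (h2 : TwoConnected G) {u v x : V} (huv : u ≠ v) (hc : OnCyc G u v)
    (h : G.Adj v x) : OnCyc G u x := by
  obtain ⟨w, c, hcyc, hu, hv⟩ := hc
  by_cases hx : x ∈ c.support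
  · exact ⟨w, c, hcyc, hu, hx⟩
  obtain ⟨b, hb, hba, R, hR, haR, hS⟩ := fan h2 (S := {y | y ∈ c.support}) (a := v) (s := u) (c := x)
    hu huv h.ne'
  obtain ⟨p, q, hp, hq, -, hs⟩ := arcs hcyc hv hb hba.symm
  have : ∃ r : G.Walk v b, r.IsPath ∧ u ∈ r.support ∧ ∀ y ∈ r.support, y ∈ c.support := by
    have hu' : u ∈ (p.toSubgraph ⊔ q.toSubgraph).verts := by
      rw [hs]; simpa using hu
    rcases hu' with hu' | hu'
    · refine ⟨p, hp, by simpa using hu', fun y hy => ?_⟩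
      have : y ∈ (p.toSubgraph ⊔ q.toSubgraph).verts := Or.inl (by simpa using hy)
      rw [hs] at this; simpa using this
    · refine ⟨q, hq, by simpa using hu', fun y hy => ?_⟩
      have : y ∈ (p.toSubgraph ⊔ q.toSubgraph).verts := Or.inr (by simpa using hy)
      rw [hs] at this; simpa using this
  obtain ⟨r, hr, hur, hrc⟩ := this
  refine ⟨x, Walk.cons h.symm (r.append R.reverse), ?_, ?_, by simp⟩
  · rw [Walk.cons_isCycle_iff]
    refine ⟨append_isPath hr hR.reverse fun y hy hy' => hS y (by simpa using hy') (hrc y hy), ?_⟩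
    rw [Walk.edges_append, List.mem_append]
    rintro (he | he)
    · exact hx (hrc _ (Walk.fst_mem_support_of_mem_edges _ he))
    · have := Walk.snd_mem_support_of_mem_edges _ he
      exact haR (by simpa using this)
  · rw [Walk.support_cons, List.mem_cons, Walk.mem_support_append_iff]
    exact Or.inr (Or.inl hur)

lemma exists_cyc [Finite V] (h2 : TwoConnected G) {u v : V} (huv : u ≠ v) : OnCyc G u v := by
  by_contra hc
  obtain ⟨a, ha, x, hx, hax⟩ := boundary h2.1 (S := {v | v = u ∨ OnCyc G u v}) (s := u) (t := v)
    (Or.inl rfl) (by rintro (h | h); exacts [huv h.symm, hc h])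
  apply hx
  by_cases hau : a = u
  · subst hau
    exact Or.inr (onCyc_adj h2 hax)
  · exact Or.inr (onCyc_step h2 (Ne.symm hau) (ha.resolve_left hau) hax)

lemma iso_cycle [Fintype V] {w : V} {c : G.Walk w w} (hc : c.IsCycle) (h3 : 3 ≤ Fintype.card V)
    (hv : ∀ x, x ∈ c.support) (he : ∀ x y, G.Adj x y → c.toSubgraph.Adj x y) :
    Nonempty (G ≃g cycleGraph (Fintype.card V)) := by
  classical
  have hl : c.length = Fintype.card V := by
    have h1 : ∀ x, x ∈ c.support.tail := by
      intro x
      have := hv x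
      rw [← Walk.cons_tail_support, List.mem_cons] at this
      rcases this with rfl | h
      · exact Walk.end_mem_tail_support hc.not_nil
      · exact h
    have h4 : c.support.tail.toFinset = Finset.univ := by
      ext x; simp [h1 x]
    have h5 := List.toFinset_card_of_nodup hc.support_nodup
    rw [h4, Finset.card_univ, List.length_tail, Walk.length_support] at h5
    omega
  obtain ⟨f⟩ := (cycleGraph_isContained_iff (by omega)).2 ⟨w, c, hc, hl⟩
  have hbij : Function.Bijective f := by
    rw [Fintype.bijective_iff_injective_and_card]
    exact ⟨f.injective, by simp⟩
  have hdeg : ∀ x, G.degree x = 2 := by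
    intro x
    have := hc.ncard_neighborSet_toSubgraph_eq_two (hv x)
    rw [← card_neighborFinset_eq_degree, ← this, ← Set.ncard_coe_finset]
    congr 1
    ext y
    simp only [coe_neighborFinset, mem_neighborSet, Subgraph.mem_neighborSet]
    exact ⟨he x y, fun h => h.adj_sub⟩
  have hdeg' : ∀ i, (cycleGraph (Fintype.card V)).degree i = 2 := by
    obtain ⟨m, hm⟩ : ∃ m, Fintype.card V = m + 3 := ⟨Fintype.card V - 3, by omega⟩
    rw [hm]
    intro i
    convert cycleGraph_degree_three_le
  have hadj : ∀ i j, G.Adj (f i) (f j) → (cycleGraph (Fintype.card V)).Adj i j := by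
    intro i j hij
    have hsub : ((cycleGraph (Fintype.card V)).neighborFinset i).image f ⊆ G.neighborFinset (f i) := by
      intro y hy
      obtain ⟨k, hk, rfl⟩ := Finset.mem_image.1 hy
      rw [mem_neighborFinset] at hk ⊢
      exact f.toHom.map_adj hk
    have heq := Finset.eq_of_subset_of_card_le hsub (by
      rw [Finset.card_image_of_injective _ (show Function.Injective (f : Fin (Fintype.card V) → V) from f.injective), card_neighborFinset_eq_degree,
        card_neighborFinset_eq_degree, hdeg, hdeg'])
    have : f j ∈ G.neighborFinset (f i) := by simpa using hij
    rw [← heq] at this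
    obtain ⟨k, hk, hkj⟩ := Finset.mem_image.1 this
    rw [f.injective hkj] at hk
    simpa using hk
  refine ⟨RelIso.symm ⟨Equiv.ofBijective f hbij, ?_⟩⟩
  intro i j
  exact ⟨hadj i j, fun h => f.toHom.map_adj h⟩

lemma base_case [Finite V] (h2 : TwoConnected G) {u v : V} (huv : u ≠ v) {w a b : V}
    {c : G.Walk w w} (hc : c.IsCycle) (hu : u ∈ c.support) (hv : v ∈ c.support)
    (ha : a ∈ c.support) (hb : b ∈ c.support) (hab : a ≠ b) {R : G.Walk a b} (hR : R.IsPath)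
    (hi : c.toSubgraph ⊓ R.toSubgraph ≤ ends G a b) :
    Nat.card V * (Nat.card V + 1) + 4 ≤ 2 * (cs (⊤ : G.Subgraph) {u, v}).ncard := by
  obtain ⟨p, q, hp, hq, hpq, hs⟩ := arcs hc ha hb hab
  have hT : Theta p q R := ⟨hp, hq, hR, hpq, by rw [hs]; exact hi, hab⟩
  have hsupp : ∀ x, x ∈ c.support → x ∈ p.support ∨ x ∈ q.support := by
    intro x hx
    have : x ∈ (p.toSubgraph ⊔ q.toSubgraph).verts := by rw [hs]; simpa using hx
    simpa using this
  have h1 := theta_pair hT (hsupp u hu) (hsupp v hv) _ rfl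
  have h3 := theta_span hT
  have hl := length_pos' hab R
  have hlp := length_pos' hab p
  have e1 : p.toSubgraph.verts.ncard ≤ p.length + 1 := by
    have := ncard_sup_le (S := ends G a b) p (by simp [ends]) (by simp [ends]) hab
    have h5 : (ends G a b).verts.ncard ≤ 2 := by
      have : (ends G a b).verts ⊆ {a, b} := by
        intro x hx
        rw [mem_ends] at hx
        simpa using hx
      exact (Set.ncard_le_ncard this (Set.toFinite _)).trans (ncard_le_two' a b)
    have h6 : p.toSubgraph.verts.ncard ≤ (ends G a b ⊔ p.toSubgraph).verts.ncard :=
      Set.ncard_le_ncard (fun x hx => Or.inr hx) (Set.toFinite _)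
    omega
  have e2 := ncard_sup_le (S := p.toSubgraph) q (by simp) (by simp) hab
  have e3 := ncard_sup_le (S := p.toSubgraph ⊔ q.toSubgraph) R (by simp) (by simp) hab
  obtain ⟨N, hN⟩ : ∃ N, p.length + q.length + R.length = N + 1 :=
    ⟨p.length + q.length + R.length - 1, by omega⟩
  refine grow h2 huv _ (p.toSubgraph ⊔ q.toSubgraph ⊔ R.toSubgraph) N le_rfl
    (Or.inl ?_) (Or.inl ?_) (by omega) ?_ (by omega)
  · simpa using hsupp u hu
  · simpa using hsupp v hv
  · rw [hN] at h1
    push_cast at h1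
    zify
    linarith

lemma main_lower [Fintype V] (h2 : TwoConnected G)
    (hnc : ¬ Nonempty (G ≃g cycleGraph (Fintype.card V))) {u v : V} (huv : u ≠ v) :
    Fintype.card V * (Fintype.card V + 1) + 4 ≤ 2 * (cs (⊤ : G.Subgraph) {u, v}).ncard := by
  rw [← Nat.card_eq_fintype_card]
  obtain ⟨w, c, hc, hu, hv⟩ := exists_cyc h2 huv
  by_cases hall : ∀ x, x ∈ c.support
  · have : ∃ x y, G.Adj x y ∧ ¬ c.toSubgraph.Adj x y := by
      by_contra hcon
      push Not at hcon
      exact hnc (iso_cycle hc (by rw [← Nat.card_eq_fintype_card]; exact h2.2.1) hall hcon)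
    obtain ⟨x, y, hxy, hn⟩ := this
    refine base_case h2 huv hc hu hv (hall x) (hall y) hxy.ne (R := Walk.cons hxy Walk.nil)
      (by simp [hxy.ne]) ⟨?_, ?_⟩
    · rintro z ⟨_, hz⟩
      rw [mem_ends]
      simpa using hz
    · rintro z t ⟨hz, hz'⟩
      exfalso
      rw [Walk.adj_toSubgraph_iff_mem_edges] at hz'
      simp only [Walk.edges_cons, Walk.edges_nil, List.mem_singleton, Sym2.eq_iff] at hz'
      rcases hz' with ⟨rfl, rfl⟩ | ⟨rfl, rfl⟩
      · exact hn hz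
      · exact hn hz.symm
  · push Not at hall
    obtain ⟨t, ht⟩ := hall
    obtain ⟨a, ha, b, hb, hab, R, hR, -, hi⟩ := exists_ear h2 (S := c.toSubgraph) (s := u) (s' := v)
      (by simpa using hu) (by simpa using hv) huv (by simpa using ht)
    exact base_case h2 huv hc hu hv (by simpa using ha) (by simpa using hb) hab hR hi

lemma main_lower' [Fintype V] (h2 : TwoConnected G)
    (hnc : ¬ Nonempty (G ≃g cycleGraph (Fintype.card V))) (u v : V) :
    Fintype.card V * (Fintype.card V + 1) + 4 ≤ 2 * numCSvw G u v := by
  have key : ∀ x y, ({H : G.Subgraph | H.Connected ∧ u ∈ H.verts ∧ v ∈ H.verts} ⊇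
      cs (⊤ : G.Subgraph) {x, y}) → x ≠ y →
      Fintype.card V * (Fintype.card V + 1) + 4 ≤ 2 * numCSvw G u v := by
    intro x y hsub hxy
    have h1 := main_lower h2 hnc hxy
    have h3 := Set.ncard_le_ncard hsub (Set.toFinite _)
    unfold numCSvw
    omega
  by_cases huv : u = v
  · subst huv
    have : ∃ w, u ≠ w := by
      have : Nontrivial V := by
        rw [← Finite.one_lt_card_iff_nontrivial]
        have := h2.2.1
        omega
      obtain ⟨w, hw⟩ := exists_ne u
      exact ⟨w, hw.symm⟩
    obtain ⟨w, hw⟩ := this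
    exact key u w (fun H hH => ⟨hH.2.1, hH.2.2 (by simp), hH.2.2 (by simp)⟩) hw
  · exact key u v (fun H hH => ⟨hH.2.1, hH.2.2 (by simp), hH.2.2 (by simp)⟩) huv

/-! ### Upper bound in two-regular graphs -/

open Classical in
/-- boundary edges of a subgraph -/
noncomputable def bd [Fintype V] (H : G.Subgraph) : Finset (Sym2 V) :=
  G.edgeFinset.filter (fun e => e ∉ H.edgeSet ∧ ∃ x ∈ e, x ∈ H.verts)

lemma mem_bd [Fintype V] {H : G.Subgraph} {x y : V} (hx : x ∈ H.verts) (h : G.Adj x y) :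
    s(x, y) ∈ bd H ↔ ¬ H.Adj x y := by
  simp only [bd, Finset.mem_filter, mem_edgeFinset, mem_edgeSet, Subgraph.mem_edgeSet]
  constructor
  · exact fun h => h.2.1
  · exact fun h' => ⟨h, h', x, by simp, hx⟩

lemma bd_verts [Fintype V] {H H' : G.Subgraph} (hD : bd H = bd H') {y z : V} (hy : y ∈ H.verts)
    (hy' : y ∈ H'.verts) (h : H.Adj y z) : H'.Adj y z := by
  by_contra hc
  have h1 := (mem_bd hy' h.adj_sub).2 hc
  rw [← hD] at h1
  exact (mem_bd hy h.adj_sub).1 h1 h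

lemma bd_le [Fintype V] {H H' : G.Subgraph} (hD : bd H = bd H') (hH : H.Connected) {u : V}
    (hu : u ∈ H.verts) (hu' : u ∈ H'.verts) : H ≤ H' := by
  have hv : ∀ (x y : H.verts) (_ : H.coe.Walk x y), (x : V) ∈ H'.verts → (y : V) ∈ H'.verts := by
    intro x y p
    induction p with
    | nil => exact id
    | @cons a b c h p ih =>
      intro ha
      exact ih (bd_verts hD a.2 ha h).snd_mem
  have hv' : ∀ x ∈ H.verts, x ∈ H'.verts := by
    intro x hx
    obtain ⟨p⟩ := hH.preconnected ⟨u, hu⟩ ⟨x, hx⟩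
    exact hv _ _ p hu'
  exact ⟨hv', fun x y h => bd_verts hD h.fst_mem (hv' x h.fst_mem) h⟩

lemma bd_card [Fintype V] (hreg : ∀ x, (G.neighborSet x).ncard = 2) {H : G.Subgraph}
    (hH : H.Connected) : (bd H).card ≤ 2 := by
  classical
  let M : V → Finset V := fun x => Finset.univ.filter (fun y => G.Adj x y ∧ ¬ H.Adj x y)
  have hM : ∀ x : H.verts, (M x).card + H.coe.degree x = 2 := by
    intro x
    rw [Subgraph.coe_degree, ← Subgraph.finset_card_neighborSet_eq_degree, ← hreg x,
      ← Finset.card_union_of_disjoint]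
    · rw [← Set.ncard_coe_finset]
      congr 1
      ext y
      simp only [M, Finset.coe_union, Finset.coe_filter, Finset.mem_univ, true_and,
        Set.mem_union, Set.mem_ofPred_eq, Set.coe_toFinset, Subgraph.mem_neighborSet,
        mem_neighborSet]
      constructor
      · rintro (h | h)
        · exact h.1
        · exact h.adj_sub
      · intro h
        by_cases h' : H.Adj x y
        · exact Or.inr h'
        · exact Or.inl ⟨h, h'⟩
    · rw [Finset.disjoint_left]
      intro y hy hy'
      simp only [M, Finset.mem_filter, Set.mem_toFinset, Subgraph.mem_neighborSet] at hy hy'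
      exact hy.2.2 hy'
  have hsub : bd H ⊆ (Finset.univ : Finset H.verts).biUnion
      (fun x => (M x).image (fun y => s((x : V), y))) := by
    intro e he
    simp only [bd, Finset.mem_filter, mem_edgeFinset] at he
    obtain ⟨h1, h2, x, hx, hxH⟩ := he
    obtain ⟨y, rfl⟩ := hx
    simp only [Finset.mem_biUnion, Finset.mem_univ, true_and, Finset.mem_image]
    exact ⟨⟨x, hxH⟩, y, by simpa [M] using ⟨h1, h2⟩, rfl⟩
  have h1 : (bd H).card ≤ ∑ x : H.verts, (M x).card :=
    (Finset.card_le_card hsub).trans (Finset.card_biUnion_le.trans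
      (Finset.sum_le_sum fun x _ => Finset.card_image_le))
  have h2 : ∑ x : H.verts, ((M x).card + H.coe.degree x) = 2 * Fintype.card H.verts := by
    rw [Finset.sum_congr rfl fun x _ => hM x]
    simp [mul_comm]
  have h5 : ∑ x : H.verts, H.coe.degree x = 2 * H.coe.edgeFinset.card := by
    convert sum_degrees_eq_twice_card_edges H.coe
  rw [Finset.sum_add_distrib, h5] at h2
  have h3 := Connected.card_vert_le_card_edgeSet_add_one hH.coe
  rw [Nat.card_eq_fintype_card, Nat.card_eq_fintype_card, ← edgeFinset_card] at h3
  omega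

lemma upper [Fintype V] (hreg : ∀ x, (G.neighborSet x).ncard = 2) (u v : V) :
    2 * numCSvw G u v ≤ Fintype.card V * (Fintype.card V + 1) + 2 := by
  classical
  have hE : G.edgeFinset.card = Fintype.card V := by
    have := sum_degrees_eq_twice_card_edges G
    have h2 : ∀ x, G.degree x = 2 := by
      intro x
      rw [← hreg x, ← card_neighborFinset_eq_degree, ← Set.ncard_coe_finset, coe_neighborFinset]
    simp only [h2, Finset.sum_const, Finset.card_univ, smul_eq_mul] at this
    omega
  let T : Finset (Finset (Sym2 V)) := (Finset.range 3).biUnion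
    (fun k => Finset.powersetCard k G.edgeFinset)
  have hT : T.card ≤ 1 + Fintype.card V + (Fintype.card V).choose 2 := by
    refine Finset.card_biUnion_le.trans ?_
    simp [Finset.sum_range_succ, Finset.card_powersetCard, hE]
  have hle : numCSvw G u v ≤ T.card := by
    rw [numCSvw, ← Set.ncard_coe_finset T]
    refine Set.ncard_le_ncard_of_injOn bd ?_ ?_ (Set.toFinite _)
    · rintro H ⟨hH, -⟩
      simp only [T, Finset.coe_biUnion, Set.mem_iUnion, Finset.mem_coe, Finset.mem_range,
        Finset.mem_powersetCard]
      exact ⟨(bd H).card, by have := bd_card hreg hH; omega, Finset.filter_subset _ _, rfl⟩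
    · rintro H ⟨hH, hu, -⟩ H' ⟨hH', hu', -⟩ hD
      exact le_antisymm (bd_le hD hH hu hu') (bd_le hD.symm hH' hu' hu)
  have hch : 2 * (Fintype.card V).choose 2 + Fintype.card V = Fintype.card V * Fintype.card V := by
    have := Nat.triangle_succ (Fintype.card V)
    rw [Nat.choose_two_right]
    have h2 := Nat.even_mul_pred_self (Fintype.card V)
    rw [Nat.two_mul_div_two_of_even h2]
    cases h : Fintype.card V with
    | zero => simp
    | succ k => simp; ring
  rw [Nat.mul_add]
  omega

end EarProof

theorem numCSvw_twoConnected_not_cycle {V : Type*} [Fintype V] (G : SimpleGraph V)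
    (n : ℕ) (hn : Fintype.card V = n) (h2c : TwoConnected G)
    (hnc : ¬ Nonempty (G ≃g cycleGraph n)) :
    ∀ u v : V, n ^ 2 + 4 < 2 * numCSvw G u v + n ∧
      ∀ u₀ v₀ : Fin n, numCSvw (cycleGraph n) u₀ v₀ < numCSvw G u v := by
  subst hn
  intro u v
  have h1 := EarProof.main_lower' h2c hnc u v
  have h3 := h2c.2.1
  rw [Nat.card_eq_fintype_card] at h3
  refine ⟨by nlinarith, fun u₀ v₀ => ?_⟩
  have h4 := EarProof.upper (G := cycleGraph (Fintype.card V)) (by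
    obtain ⟨m, hm⟩ : ∃ m, Fintype.card V = m + 3 := ⟨Fintype.card V - 3, by omega⟩
    rw [hm]
    intro i
    rw [← cycleGraph_degree_three_le (v := i), ← card_neighborFinset_eq_degree,
      ← Set.ncard_coe_finset, coe_neighborFinset]) u₀ v₀
  rw [Fintype.card_fin] at h4
  omega
end

section
/- Let T be a tree on n vertices with exactly k cut vertices (equivalently n - k leaves), 1 ≤ k ≤ n - 2. Then the minimum over all vertices v of T of the number of subtrees containing v is minimized, among all such trees, uniquely by the broom P_{k+1, n-k-1} (path on k+1 vertices with n - k - 1 extra leaves attached to one end) at its path-end pendant vertex v_0, and f(v_0) = 2^{n-k-1} + k. -/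
open SimpleGraph

structure BRooted {V : Type*} (G : SimpleGraph V) (r : V) (p : V → V) (d : V → ℕ) : Prop where
  pr : p r = r
  dr : d r = 0
  dp : ∀ x, x ≠ r → d (p x) + 1 = d x
  adj : ∀ x y, G.Adj x y ↔ (x ≠ r ∧ y = p x) ∨ (y ≠ r ∧ x = p y)

theorem BRooted.of_tree {V : Type*} {T : SimpleGraph V} (hT : T.IsTree) (r : V) :
    ∃ p d, BRooted T r p d := by
  classical
  have hex : ∀ x, ∃ y, (x = r → y = r) ∧ (x ≠ r → T.Adj x y ∧ T.dist r y + 1 = T.dist r x ∧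
      ∀ z, T.Adj x z → T.dist r z + 1 = T.dist r x → z = y) := by
    intro x
    by_cases hx : x = r
    · exact ⟨r, fun _ => rfl, fun h => absurd hx h⟩
    obtain ⟨w, hw, hl⟩ := hT.1.exists_path_of_dist r x
    have hnil : ¬ w.Nil := fun h => hx h.eq.symm
    have hadj : T.Adj w.penultimate x := w.adj_penultimate hnil
    refine ⟨w.penultimate, fun h => absurd h hx, fun _ => ?_⟩
    have huniq : ∀ z, T.Adj x z → T.dist r z + 1 = T.dist r x → z = w.penultimate := by
      intro z hz hd
      obtain ⟨q, hq, hql⟩ := hT.1.exists_path_of_dist r z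
      have h1 : (q.concat hz.symm).IsPath := by
        apply Walk.isPath_of_length_eq_dist
        rw [Walk.length_concat]; omega
      have h2 := (hT.existsUnique_path r x).unique h1 hw
      rw [← h2, Walk.penultimate_concat]
    refine ⟨hadj.symm, ?_, huniq⟩
    have h1 : T.dist r w.penultimate ≤ w.dropLast.length := T.dist_le _
    have h2 : w.dropLast.length + 1 = w.length := Walk.length_dropLast_add_one hnil
    have h3 := hT.dist_eq_dist_add_one_of_adj r hadj
    omega
  choose p hp1 hp2 using hex
  refine ⟨p, T.dist r, hp1 r rfl, by simp, fun x hx => (hp2 x hx).2.1, fun x y => ?_⟩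
  have hrr : T.dist r r = 0 := by simp
  constructor
  · intro h
    rcases hT.dist_eq_dist_add_one_of_adj r h with h1 | h1
    · have hx : x ≠ r := by rintro rfl; omega
      exact Or.inl ⟨hx, (hp2 x hx).2.2 y h h1.symm⟩
    · have hy : y ≠ r := by rintro rfl; omega
      exact Or.inr ⟨hy, (hp2 y hy).2.2 x h.symm h1.symm⟩
  · rintro (⟨h, rfl⟩ | ⟨h, rfl⟩)
    · exact (hp2 x h).1
    · exact (hp2 y h).1.symm

section
variable {V : Type*} {G : SimpleGraph V} {r : V} {p : V → V} {d : V → ℕ}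

theorem BRooted.adj_parent (R : BRooted G r p d) {H : G.Subgraph} (hc : H.Connected)
    (hr : r ∈ H.verts) {x : V} (hx : x ∈ H.verts) (hxr : x ≠ r) : H.Adj x (p x) := by
  obtain ⟨w⟩ := hc.coe ⟨x, hx⟩ ⟨r, hr⟩
  obtain ⟨e, -, he1, he2⟩ := w.exists_boundary_dart {y | ∃ i : ℕ, p^[i] y.1 = x} ⟨0, rfl⟩ (by
    rintro ⟨i, hi⟩
    simp only [Function.iterate_fixed R.pr] at hi
    exact hxr hi.symm)
  have hadj : H.Adj e.fst.1 e.snd.1 := e.adj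
  obtain ⟨i, hi⟩ := he1
  rcases (R.adj _ _).1 hadj.adj_sub with ⟨h1, h2⟩ | ⟨h1, h2⟩
  · cases i with
    | zero =>
      simp only [Function.iterate_zero, id] at hi
      rw [hi] at hadj h2
      rwa [h2] at hadj
    | succ i =>
      exact absurd ⟨i, by rw [h2]; exact hi⟩ he2
  · exact absurd ⟨i + 1, by rw [Function.iterate_succ_apply, ← h2]; exact hi⟩ he2

theorem BRooted.connected (R : BRooted G r p d) {S : Set V} (hr : r ∈ S)
    (hS : ∀ x ∈ S, p x ∈ S) : ((⊤ : G.Subgraph).induce S).Connected := by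
  constructor
  rw [connected_iff_exists_forall_reachable]
  refine ⟨⟨r, hr⟩, ?_⟩
  have key : ∀ m, ∀ x (hx : x ∈ S), d x = m →
      ((⊤ : G.Subgraph).induce S).coe.Reachable ⟨r, hr⟩ ⟨x, hx⟩ := by
    intro m
    induction m with
    | zero =>
      intro x hx h
      by_cases hxr : x = r
      · subst hxr; exact Reachable.refl _
      · have := R.dp x hxr; omega
    | succ m ih =>
      intro x hx h
      have hxr : x ≠ r := by rintro rfl; have := R.dr; omega
      have hd := R.dp x hxr
      refine (ih (p x) (hS x hx) (by omega)).trans (Adj.reachable ?_)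
      have : G.Adj (p x) x := (R.adj _ _).2 (Or.inr ⟨hxr, rfl⟩)
      simpa using ⟨hS x hx, hx, this⟩
  exact fun w => key _ w.1 w.2 rfl

open Classical in
noncomputable def bClosed [Fintype V] (r : V) (p : V → V) : Finset (Finset V) :=
  Finset.univ.filter (fun S => r ∈ S ∧ ∀ x ∈ S, p x ∈ S)

theorem mem_bClosed [Fintype V] {S : Finset V} :
    S ∈ bClosed r p ↔ r ∈ S ∧ ∀ x ∈ S, p x ∈ S := by simp [bClosed]

theorem BRooted.numCSv_eq [Fintype V] (R : BRooted G r p d) :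
    numCSv G r = (bClosed r p).card := by
  classical
  unfold numCSv
  rw [← Set.ncard_coe_finset]
  refine Set.ncard_congr (fun H _ => H.verts.toFinset) ?_ ?_ ?_
  · rintro H ⟨hc, hr⟩
    simp only [Finset.mem_coe, mem_bClosed, Set.mem_toFinset]
    refine ⟨hr, fun x hx => ?_⟩
    by_cases hxr : x = r
    · rw [hxr, R.pr]; exact hr
    · exact (R.adj_parent hc hr hx hxr).snd_mem
  · rintro H K ⟨hc, hr⟩ ⟨hc', hr'⟩ h
    have hv : H.verts = K.verts := Set.toFinset_inj.1 h
    have aux : ∀ (H K : G.Subgraph), K.Connected → r ∈ K.verts → H.verts = K.verts →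
        ∀ x y, H.Adj x y → K.Adj x y := by
      intro H K hK hr hv x y hxy
      rcases (R.adj _ _).1 hxy.adj_sub with ⟨h1, h2⟩ | ⟨h1, h2⟩
      · rw [h2]; exact R.adj_parent hK hr (hv ▸ hxy.fst_mem) h1
      · rw [h2]; exact (R.adj_parent hK hr (hv ▸ hxy.snd_mem) h1).symm
    ext x y
    · rw [hv]
    · exact ⟨aux H K hc' hr' hv x y, aux K H hc hr hv.symm x y⟩
  · intro S hS
    simp only [Finset.mem_coe, mem_bClosed] at hS
    exact ⟨(⊤ : G.Subgraph).induce S, ⟨R.connected (by exact_mod_cast hS.1)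
      (by exact_mod_cast hS.2), by simpa using hS.1⟩, by ext; simp⟩

theorem BRooted.noChild (R : BRooted G r p d) {x y : V} (hx : ¬ IsCutVertex G x) (hxr : x ≠ r)
    (hy : y ≠ r) : p y ≠ x := by
  intro h
  unfold IsCutVertex at hx
  rw [not_not, connected_induce_iff] at hx
  have hyx : y ≠ x := by
    rintro rfl
    have := R.dp y hy
    rw [h] at this; omega
  have := (R.adj_parent hx (by simpa using hxr.symm) (by simpa using hyx) hy).snd_mem
  simp [h] at this

theorem BRooted.sizes [Fintype V] (R : BRooted G r p d) : ∀ (m : ℕ) (B : Finset V), B.card = m →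
    B ∈ bClosed r p → ∀ i, 1 ≤ i → i ≤ m → ∃ S ∈ bClosed r p, S ⊆ B ∧ S.card = i := by
  classical
  intro m
  induction m with
  | zero => intro B _ _ i h1 h2; omega
  | succ m ih =>
    intro B hB hc i h1 h2
    rcases Nat.lt_or_ge m i with h | h
    · exact ⟨B, hc, subset_rfl, by omega⟩
    have hc' := mem_bClosed.1 hc
    obtain ⟨x, hx, hmax⟩ := B.exists_max_image d ⟨r, hc'.1⟩
    have hxr : x ≠ r := by
      rintro rfl
      obtain ⟨y, hy, hyx⟩ := B.exists_mem_ne (by omega) x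
      have := hmax y hy
      have := R.dp y hyx
      have := R.dr
      omega
    obtain ⟨S, hS1, hS2, hS3⟩ := ih (B.erase x) (by rw [Finset.card_erase_of_mem hx]; omega)
      (mem_bClosed.2 ⟨Finset.mem_erase.2 ⟨hxr.symm, hc'.1⟩, fun y hy => by
        have hy' := Finset.mem_erase.1 hy
        refine Finset.mem_erase.2 ⟨?_, hc'.2 y hy'.2⟩
        intro h
        by_cases hyr : y = r
        · rw [hyr, R.pr] at h; exact hxr h.symm
        · have := R.dp y hyr
          have := hmax y hy'.2
          rw [h] at *
          omega⟩) i h1 h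
    exact ⟨S, hS1, hS2.trans (Finset.erase_subset _ _), hS3⟩

theorem BRooted.count [Fintype V] (R : BRooted G r p d) (B : Finset V) (hB : B ∈ bClosed r p)
    (hp : ∀ y, p y ∈ B) :
    2 ^ (Fintype.card V - B.card) + (B.card - 1) ≤ (bClosed r p).card ∧
    ((bClosed r p).card = 2 ^ (Fintype.card V - B.card) + (B.card - 1) →
      (∀ S ∈ bClosed r p, ¬ B ⊆ S → S ⊆ B) ∧
      (∀ S ∈ bClosed r p, ∀ S' ∈ bClosed r p, ¬ B ⊆ S → ¬ B ⊆ S' → S.card = S'.card → S = S')) := by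
  classical
  have hB' := mem_bClosed.1 hB
  set F := bClosed r p with hF
  have hsplit := Finset.card_filter_add_card_filter_not (s := F) (fun S => B ⊆ S)
  have h1 : 2 ^ (Fintype.card V - B.card) ≤ (F.filter (fun S => B ⊆ S)).card := by
    rw [← Finset.card_compl, ← Finset.card_powerset]
    refine Finset.card_le_card_of_injOn (fun S => B ∪ S) ?_ ?_
    · intro S _
      simp only [Finset.coe_filter, Set.mem_ofPred_eq, hF, mem_bClosed]
      exact ⟨⟨Finset.mem_union_left _ hB'.1, fun x _ => Finset.mem_union_left _ (hp x)⟩,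
        Finset.subset_union_left⟩
    · intro S hS S' hS' h
      simp only [Finset.coe_powerset, Set.mem_preimage, Set.mem_powerset_iff, Finset.coe_subset] at hS hS'
      have h : B ∪ S = B ∪ S' := h
      ext x
      have hx := Finset.ext_iff.1 h x
      have a := @hS x
      have b := @hS' x
      simp only [Finset.mem_union, Finset.mem_compl] at hx a b
      tauto
  set F2 := F.filter (fun S => ¬ B ⊆ S) with hF2
  set F3 := F2.filter (fun S => S ⊆ B) with hF3
  have h3 : Finset.Ico 1 B.card ⊆ F3.image Finset.card := by
    intro i hi
    rw [Finset.mem_Ico] at hi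
    obtain ⟨S, a, b, c⟩ := R.sizes _ B rfl hB i hi.1 hi.2.le
    refine Finset.mem_image.2 ⟨S, ?_, c⟩
    simp only [hF3, hF2, Finset.mem_filter]
    refine ⟨⟨a, fun h => ?_⟩, b⟩
    have := Finset.card_le_card h
    omega
  have h4 := Finset.card_le_card h3
  rw [Nat.card_Ico] at h4
  have h5 : (F3.image Finset.card).card ≤ F3.card := Finset.card_image_le
  have h6 : F3.card ≤ F2.card := Finset.card_filter_le _ _
  refine ⟨by omega, fun heq => ?_⟩
  have e1 : F3 = F2 := Finset.eq_of_subset_of_card_le (Finset.filter_subset _ _) (by omega)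
  have e2 : Set.InjOn Finset.card (F3 : Set (Finset V)) := Finset.card_image_iff.1 (by omega)
  rw [e1] at e2
  constructor
  · intro S hS hn
    have : S ∈ F3 := by rw [e1]; exact Finset.mem_filter.2 ⟨hS, hn⟩
    exact (Finset.mem_filter.1 this).2
  · intro S hS S' hS' hn hn' hc
    exact e2 (Finset.mem_coe.2 (Finset.mem_filter.2 ⟨hS, hn⟩))
      (Finset.mem_coe.2 (Finset.mem_filter.2 ⟨hS', hn'⟩)) hc

theorem BRooted.structure_eq [Fintype V] (R : BRooted G r p d) (B : Finset V)
    (hB : B ∈ bClosed r p) (hp : ∀ y, p y ∈ B) (k : ℕ) (hk : B.card = k + 1)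
    (hc : (bClosed r p).card = 2 ^ (Fintype.card V - B.card) + (B.card - 1)) :
    Set.InjOn d B ∧ (∀ x ∈ B, d x ≤ k) ∧ (∀ x, x ∉ B → d x = k + 1) := by
  classical
  obtain ⟨c1, c2⟩ := (R.count B hB hp).2 hc
  have hB' := mem_bClosed.1 hB
  have hcl : ∀ u, u ≠ r → insert u (B.filter (fun z => d z < d u)) ∈ bClosed r p := by
    intro u hu
    have h0 := R.dp u hu
    have hr0 := R.dr
    rw [mem_bClosed]
    refine ⟨Finset.mem_insert_of_mem (Finset.mem_filter.2 ⟨hB'.1, by omega⟩), ?_⟩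
    intro y hy
    refine Finset.mem_insert_of_mem (Finset.mem_filter.2 ⟨hp y, ?_⟩)
    by_cases hyr : y = r
    · rw [hyr, R.pr]; omega
    have h2 := R.dp y hyr
    rcases Finset.mem_insert.1 hy with rfl | h
    · omega
    · have := (Finset.mem_filter.1 h).2
      omega
  have hinj : Set.InjOn d B := by
    intro x hx y hy hxy
    by_contra hne
    have hx0 : x ≠ r := by
      rintro rfl
      have := R.dp y (Ne.symm hne)
      have := R.dr
      omega
    have hy0 : y ≠ r := by
      rintro rfl
      have := R.dp x hne
      have := R.dr
      omega
    have hn1 : y ∉ insert x (B.filter (fun z => d z < d x)) := by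
      simp [Ne.symm hne, hxy]
    have hn2 : x ∉ insert y (B.filter (fun z => d z < d y)) := by
      simp [hne, hxy]
    have := c2 _ (hcl x hx0) _ (hcl y hy0) (fun h => hn1 (h hy)) (fun h => hn2 (h hx)) (by
      rw [Finset.card_insert_of_notMem (by simp), Finset.card_insert_of_notMem (by simp), hxy])
    apply hn2
    rw [← this]
    exact Finset.mem_insert_self _ _
  have hdown : ∀ m, ∀ x ∈ B, d x = m → Finset.range (m + 1) ⊆ B.image d := by
    intro m
    induction m with
    | zero =>
      intro x hx h i hi
      have : i = 0 := by simpa using hi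
      exact Finset.mem_image.2 ⟨x, hx, by omega⟩
    | succ m ih =>
      intro x hx h i hi
      have hxr : x ≠ r := by rintro rfl; have := R.dr; omega
      have hd := R.dp x hxr
      rcases Nat.lt_or_ge i (m + 1) with h' | h'
      · exact ih (p x) (hp x) (by omega) (Finset.mem_range.2 h')
      · have : i < m + 1 + 1 := Finset.mem_range.1 hi
        exact Finset.mem_image.2 ⟨x, hx, by omega⟩
  have hcard : (B.image d).card = k + 1 := by rw [Finset.card_image_of_injOn hinj, hk]
  have hle : ∀ x ∈ B, d x ≤ k := by
    intro x hx
    have := Finset.card_le_card (hdown _ x hx rfl)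
    rw [Finset.card_range] at this
    omega
  refine ⟨hinj, hle, ?_⟩
  have himg : B.image d = Finset.range (k + 1) := by
    apply Finset.eq_of_subset_of_card_le
    · intro i hi
      obtain ⟨x, hx, rfl⟩ := Finset.mem_image.1 hi
      have := hle x hx
      exact Finset.mem_range.2 (by omega)
    · rw [hcard, Finset.card_range]
  intro u hu
  have hur : u ≠ r := fun h => hu (h ▸ hB'.1)
  have h1 := R.dp u hur
  have h2 := hle _ (hp u)
  have h3 : B ⊆ insert u (B.filter (fun z => d z < d u)) := by
    by_contra h
    exact hu (c1 _ (hcl u hur) h (Finset.mem_insert_self _ _))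
  have h4 : k ∈ B.image d := by rw [himg]; simp
  obtain ⟨z, hz, hzk⟩ := Finset.mem_image.1 h4
  rcases Finset.mem_insert.1 (h3 hz) with rfl | h
  · exact absurd hz hu
  · have := (Finset.mem_filter.1 h).2
    omega

end

def bPar (n k : ℕ) (i : Fin n) : Fin n := ⟨min (i.val - 1) k, by omega⟩

theorem broom_rooted (n k : ℕ) (hkn : k + 2 ≤ n) :
    BRooted (broom n k) ⟨0, by omega⟩ (bPar n k) (fun i => min i.val (k + 1)) where
  pr := by simp [bPar]
  dr := by simp
  dp := by
    rintro ⟨x, hx⟩ h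
    simp only [ne_eq, Fin.mk.injEq] at h
    simp only [bPar]
    omega
  adj := by
    rintro ⟨x, hx⟩ ⟨y, hy⟩
    simp only [broom, SimpleGraph.fromRel_adj, bPar, ne_eq, Fin.mk.injEq]
    omega

theorem broom_closed_card (n k : ℕ) (hkn : k + 2 ≤ n) :
    (bClosed (⟨0, by omega⟩ : Fin n) (bPar n k)).card = 2 ^ (n - k - 1) + k := by
  classical
  let B : Finset (Fin n) := Finset.univ.filter (fun i => i.val ≤ k)
  have hBc : B.card = k + 1 := by
    have : B = Finset.Iic (⟨k, by omega⟩ : Fin n) := by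
      ext i; simp [B, Fin.le_def]
    rw [this, Fin.card_Iic]
  have hp : ∀ y, bPar n k y ∈ B := by
    intro y; simp [B, bPar]
  have hB : B ∈ bClosed (⟨0, by omega⟩ : Fin n) (bPar n k) := by
    rw [mem_bClosed]
    exact ⟨by simp [B], fun x _ => hp x⟩
  have hlow := ((broom_rooted n k hkn).count B hB hp).1
  rw [hBc, Fintype.card_fin] at hlow
  have e : n - (k + 1) = n - k - 1 := by omega
  rw [e] at hlow
  refine le_antisymm ?_ (by simpa using hlow)
  have hsub : bClosed (⟨0, by omega⟩ : Fin n) (bPar n k) ⊆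
      (Bᶜ.powerset.image (fun S => B ∪ S)) ∪
      ((Finset.range k).image (fun i => Finset.univ.filter (fun j : Fin n => j.val ≤ i))) := by
    intro S hS
    rw [mem_bClosed] at hS
    rw [Finset.mem_union]
    by_cases hBS : B ⊆ S
    · left
      refine Finset.mem_image.2 ⟨S \ B, ?_, Finset.union_sdiff_of_subset hBS⟩
      rw [Finset.mem_powerset]
      intro x hx
      rw [Finset.mem_compl]
      exact (Finset.mem_sdiff.1 hx).2
    · right
      have hdn : ∀ m, ∀ j : Fin n, j.val ≤ k → ∀ (hm : j.val + m < n), j.val + m ≤ k →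
          (⟨j.val + m, hm⟩ : Fin n) ∈ S → j ∈ S := by
        intro m
        induction m with
        | zero => intro j _ _ _ h; exact h
        | succ m ih =>
          intro j hj hm hmk h
          refine ih j hj (by omega) (by omega) ?_
          have := hS.2 _ h
          convert this using 1
          simp only [bPar, Fin.mk.injEq]
          omega
      have hdn' : ∀ j i : Fin n, j ≤ i → i.val ≤ k → i ∈ S → j ∈ S := by
        intro j i hji hik hi
        have hji' : j.val ≤ i.val := hji
        refine hdn (i.val - j.val) j (by omega) (by omega) (by omega) ?_
        convert hi using 1
        ext; simp; omega
      have hSk : ∀ i ∈ S, i.val < k := by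
        intro i hi
        by_contra h
        apply hBS
        intro j hj
        have hj : j.val ≤ k := by simpa [B] using hj
        have hkS : (⟨k, by omega⟩ : Fin n) ∈ S := by
          rcases Nat.lt_or_ge k i.val with h' | h'
          · have := hS.2 _ hi
            convert this using 1
            simp only [bPar, Fin.mk.injEq]
            omega
          · convert hi using 1
            ext; simp; omega
        exact hdn' j _ hj le_rfl hkS
      obtain ⟨m, hm, hmax⟩ := S.exists_max_image id ⟨_, hS.1⟩
      refine Finset.mem_image.2 ⟨m.val, Finset.mem_range.2 (hSk m hm), ?_⟩
      ext j
      simp only [Finset.mem_filter, Finset.mem_univ, true_and]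
      exact ⟨fun h => hdn' j m h (hSk m hm).le hm, fun h => hmax j h⟩
  refine (Finset.card_le_card hsub).trans ((Finset.card_union_le _ _).trans (Nat.add_le_add ?_ ?_))
  · refine Finset.card_image_le.trans ?_
    rw [Finset.card_powerset, Finset.card_compl, hBc, Fintype.card_fin, e]
  · exact Finset.card_image_le.trans (by simp)

theorem BRooted.iso {V : Type*} [Fintype V] {G : SimpleGraph V} {r : V} {p : V → V} {d : V → ℕ}
    (R : BRooted G r p d) (B : Finset V) (hr : r ∈ B) (hp : ∀ y, p y ∈ B) (n k : ℕ)
    (hn : Fintype.card V = n)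
    (hkn : k + 2 ≤ n) (hk : B.card = k + 1) (h1 : Set.InjOn d B) (h2 : ∀ x ∈ B, d x ≤ k)
    (h3 : ∀ x, x ∉ B → d x = k + 1) : ∃ φ : G ≃g broom n k, φ r = ⟨0, by omega⟩ := by
  classical
  have hcc : Fintype.card {x // x ∉ B} = n - (k + 1) := by
    rw [Fintype.card_subtype_compl, hn, Fintype.card_coe, hk]
  let e := Fintype.equivFinOfCardEq hcc
  let f : V → Fin n := fun x => if h : x ∈ B then ⟨d x, by have := h2 x h; omega⟩
    else ⟨k + 1 + (e ⟨x, h⟩).val, by have := (e ⟨x, h⟩).2; omega⟩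
  have fB : ∀ x, x ∈ B → (f x).val = d x := by
    intro x hx; simp only [f, dif_pos hx]
  have fN : ∀ x (h : x ∉ B), (f x).val = k + 1 + (e ⟨x, h⟩).val := by
    intro x hx; simp only [f, dif_neg hx]
  have finj : Function.Injective f := by
    intro x y hxy
    have hv : (f x).val = (f y).val := by rw [hxy]
    by_cases hx : x ∈ B <;> by_cases hy : y ∈ B
    · rw [fB x hx, fB y hy] at hv
      exact h1 hx hy hv
    · rw [fB x hx, fN y hy] at hv
      have := h2 x hx; omega
    · rw [fN x hx, fB y hy] at hv
      have := h2 y hy; omega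
    · rw [fN x hx, fN y hy] at hv
      have : e ⟨x, hx⟩ = e ⟨y, hy⟩ := Fin.ext (by omega)
      simpa using e.injective this
  have fbij : Function.Bijective f :=
    (Fintype.bijective_iff_injective_and_card f).2 ⟨finj, by simp [hn]⟩
  have fr : f r = ⟨0, by omega⟩ := Fin.ext (by rw [fB r hr, R.dr])
  have fp : ∀ x, x ≠ r → f (p x) = bPar n k (f x) := by
    intro x hx
    apply Fin.ext
    have hd := R.dp x hx
    rw [fB _ (hp x)]
    simp only [bPar]
    by_cases hxB : x ∈ B
    · rw [fB x hxB]; have := h2 x hxB; omega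
    · rw [fN x hxB]; have := h3 x hxB; omega
  have fne : ∀ x, f x ≠ ⟨0, by omega⟩ ↔ x ≠ r := by
    intro x; rw [← fr]; exact finj.ne_iff
  refine ⟨⟨Equiv.ofBijective f fbij, ?_⟩, fr⟩
  intro x y
  simp only [Equiv.ofBijective_apply]
  rw [(broom_rooted n k hkn).adj, R.adj, fne, fne]
  refine or_congr (and_congr_right fun h => ?_) (and_congr_right fun h => ?_)
  · rw [← fp x h]; exact finj.eq_iff
  · rw [← fp y h]; exact finj.eq_iff

theorem broom_minimizes_numCSv {V : Type*} [Fintype V] (T : SimpleGraph V)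
    (n k : ℕ) (hn : Fintype.card V = n) (hT : T.IsTree)
    (hk : {v : V | IsCutVertex T v}.ncard = k) (hk1 : 1 ≤ k) (hkn : k + 2 ≤ n) :
    numCSv (broom n k) ⟨0, by omega⟩ = 2 ^ (n - k - 1) + k ∧
    (∀ v : V, 2 ^ (n - k - 1) + k ≤ numCSv T v) ∧
    (∀ v : V, numCSv T v = 2 ^ (n - k - 1) + k →
      ∃ φ : T ≃g broom n k, φ v = ⟨0, by omega⟩) := by
  classical
  refine ⟨?_, ?_⟩
  · rw [(broom_rooted n k hkn).numCSv_eq, broom_closed_card n k hkn]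
  rw [← forall_and]
  intro v
  obtain ⟨p, d, R⟩ := BRooted.of_tree hT v
  rw [R.numCSv_eq]
  let C : Finset V := Finset.univ.filter (fun x => IsCutVertex T x)
  have hC : C.card = k := by
    rw [← hk, ← Set.ncard_coe_finset]; simp [C]
  have hv : v ∈ insert v C := Finset.mem_insert_self _ _
  have hp : ∀ y, p y ∈ insert v C := by
    intro y
    by_cases hy : y = v
    · rw [hy, R.pr]; exact hv
    by_contra h
    simp only [Finset.mem_insert, C, Finset.mem_filter, Finset.mem_univ, true_and, not_or] at h
    exact R.noChild h.2 h.1 hy rfl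
  have hB : insert v C ∈ bClosed v p := mem_bClosed.2 ⟨hv, fun x _ => hp x⟩
  have hcount := (R.count _ hB hp).1
  by_cases hvC : v ∈ C
  · rw [Finset.insert_eq_of_mem hvC, hC, hn] at hcount
    obtain ⟨m, rfl⟩ : ∃ m, n = k + 2 + m := ⟨n - (k + 2), by omega⟩
    have e1 : k + 2 + m - k = m + 2 := by omega
    have e2 : k + 2 + m - k - 1 = m + 1 := by omega
    rw [e1] at hcount
    rw [e2]
    have : 1 ≤ 2 ^ m := Nat.one_le_two_pow
    rw [pow_succ, pow_succ] at hcount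
    rw [pow_succ]
    exact ⟨by omega, fun h => by omega⟩
  · have hcard : (insert v C).card = k + 1 := by rw [Finset.card_insert_of_notMem hvC, hC]
    have e : n - (k + 1) = n - k - 1 := by omega
    refine ⟨by simpa [hcard, hn, e] using hcount, fun h => ?_⟩
    obtain ⟨a, b, c⟩ := R.structure_eq _ hB hp k hcard (by rw [h, hcard, hn, e]; simp)
    exact R.iso _ hv hp n k hn hkn hcard a b c
end

section
/- Let L_{n, n-k} be the graph obtained by identifying one endpoint of a path on k+1 vertices with a vertex of the cycle C_{n-k} (so L_{n,n-k} has n vertices and k cut vertices), and let v_0 be its pendant vertex. Then f_{L_{n,n-k}}(v_0) = ((n-k)^2 + n + k + 2)/2, and the total number of connected subgraphs is F(L_{n,n-k}) = (k/2)(n^2 + k^2 - 2nk + n + 3) + (n-k)^2 + 1. -/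
open SimpleGraph

theorem conn_of_closed {V : Type*} {G : SimpleGraph V} (H : G.Subgraph) (u : V) (hu : u ∈ H.verts)
    (h : ∀ S : Set V, u ∈ S → (∀ x y, H.Adj x y → x ∈ S → y ∈ S) → H.verts ⊆ S) : H.Connected := by
  have key : ∀ v (hv : v ∈ H.verts), H.coe.Reachable ⟨u, hu⟩ ⟨v, hv⟩ := by
    intro v hv
    have := h {x | ∃ hx : x ∈ H.verts, H.coe.Reachable ⟨u, hu⟩ ⟨x, hx⟩} ⟨hu, Reachable.refl _⟩ (by
      rintro x y hxy ⟨hx, hr⟩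
      refine ⟨H.edge_vert hxy.symm, hr.trans ?_⟩
      apply SimpleGraph.Adj.reachable
      exact hxy) hv
    exact this.2
  rw [Subgraph.connected_iff']
  haveI : Nonempty H.verts := ⟨⟨u, hu⟩⟩
  refine ⟨?_⟩
  rintro ⟨x, hx⟩ ⟨y, hy⟩
  exact (key x hx).symm.trans (key y hy)

theorem closed_of_conn {V : Type*} {G : SimpleGraph V} (H : G.Subgraph) (hH : H.Connected)
    (S : Set V) (u w : V) (hu : u ∈ H.verts) (hw : w ∈ H.verts) (huS : u ∈ S) (hwS : w ∉ S) :
    ∃ x y, H.Adj x y ∧ x ∈ S ∧ y ∉ S := by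
  by_contra hcon
  push Not at hcon
  rw [Subgraph.connected_iff'] at hH
  obtain ⟨p⟩ := hH.preconnected ⟨u, hu⟩ ⟨w, hw⟩
  have : ∀ (a b : H.verts), H.coe.Walk a b → a.1 ∈ S → b.1 ∈ S := by
    intro a b p
    induction p with
    | nil => exact id
    | cons hab _ ih => exact fun ha => ih (hcon _ _ hab ha)
  exact hwS (this _ _ p huS)

/-- edge relation in positions -/
def QA (n k : ℕ) (i j : ℕ) : Prop :=
  i + 1 = j ∨ j + 1 = i ∨ (i = k ∧ j + 1 = n) ∨ (j = k ∧ i + 1 = n)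

def fI {V : Type*} (G : SimpleGraph V) (p : V → ℕ) (x : ℕ × ℕ) : G.Subgraph where
  verts := {v | x.1 ≤ p v ∧ p v ≤ x.2}
  Adj u v := G.Adj u v ∧ (x.1 ≤ p u ∧ p u ≤ x.2) ∧ (x.1 ≤ p v ∧ p v ≤ x.2) ∧
    (p u + 1 = p v ∨ p v + 1 = p u)
  adj_sub h := h.1
  edge_vert h := h.2.1
  symm := ⟨fun u v h => ⟨h.1.symm, h.2.2.1, h.2.1, h.2.2.2.symm⟩⟩

def fII {V : Type*} (n k : ℕ) (G : SimpleGraph V) (p : V → ℕ) (x : ℕ × (ℕ × ℕ)) : G.Subgraph where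
  verts := {v | (x.1 ≤ p v ∧ p v ≤ x.2.1) ∨ x.2.2 ≤ p v}
  Adj u v := G.Adj u v ∧ ((x.1 ≤ p u ∧ p u ≤ x.2.1) ∨ x.2.2 ≤ p u) ∧
    ((x.1 ≤ p v ∧ p v ≤ x.2.1) ∨ x.2.2 ≤ p v) ∧
    ((p u ≤ x.2.1 ∧ p v ≤ x.2.1 ∧ (p u + 1 = p v ∨ p v + 1 = p u)) ∨
     (x.2.2 ≤ p u ∧ x.2.2 ≤ p v ∧ (p u + 1 = p v ∨ p v + 1 = p u)) ∨
     (p u = k ∧ p v + 1 = n) ∨ (p v = k ∧ p u + 1 = n))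
  adj_sub h := h.1
  edge_vert h := h.2.1
  symm := ⟨fun u v h => ⟨h.1.symm, h.2.2.1, h.2.1, by tauto⟩⟩

def VI (n : ℕ) (x : ℕ × ℕ) : Prop := x.1 ≤ x.2 ∧ x.2 < n
def VII (n k : ℕ) (x : ℕ × (ℕ × ℕ)) : Prop :=
  x.1 ≤ k ∧ ((k ≤ x.2.1 ∧ x.2.1 < x.2.2 ∧ x.2.2 < n) ∨ (x.2.1 + 1 = n ∧ x.2.2 = n))

section
variable {V : Type*} {G : SimpleGraph V} {p : V → ℕ} {q : ℕ → V} {n k : ℕ}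

theorem fI_conn (hkn : k + 3 ≤ n) (hpq : ∀ i < n, p (q i) = i) (hqp : ∀ v, q (p v) = v)
    (hG : ∀ u v, G.Adj u v ↔ QA n k (p u) (p v)) (x : ℕ × ℕ) (hx : VI n x) :
    (fI G p x).Connected := by
  obtain ⟨a, b⟩ := x
  obtain ⟨h1, h2⟩ := hx
  simp only at h1 h2
  apply conn_of_closed _ (q a)
  · simp only [fI, Set.mem_ofPred_eq]; rw [hpq a (by omega)]; omega
  · intro S ha hS
    have : ∀ d, a + d ≤ b → q (a + d) ∈ S := by
      intro d
      induction d with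
      | zero => intro _; exact ha
      | succ d ih =>
        intro hd
        refine hS (q (a + d)) _ ?_ (ih (by omega))
        simp only [fI, hG, QA]
        rw [hpq _ (by omega), hpq _ (by omega)]
        omega
    intro v hv
    simp only [fI, Set.mem_ofPred_eq] at hv
    have := this (p v - a) (by omega)
    rwa [show a + (p v - a) = p v by omega, hqp] at this

theorem fII_conn (hkn : k + 3 ≤ n) (hpq : ∀ i < n, p (q i) = i) (hqp : ∀ v, q (p v) = v)
    (hp : ∀ v, p v < n)
    (hG : ∀ u v, G.Adj u v ↔ QA n k (p u) (p v)) (x : ℕ × (ℕ × ℕ)) (hx : VII n k x) :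
    (fII n k G p x).Connected := by
  obtain ⟨a, b, c⟩ := x
  obtain ⟨h1, h2⟩ := hx
  simp only at h1 h2
  apply conn_of_closed _ (q k)
  · simp only [fII, Set.mem_ofPred_eq]; rw [hpq k (by omega)]; omega
  · intro S ha hS
    have up : ∀ d, k + d ≤ b → q (k + d) ∈ S := by
      intro d
      induction d with
      | zero => intro _; exact ha
      | succ d ih =>
        intro hd
        refine hS (q (k + d)) _ ?_ (ih (by omega))
        simp only [fII, hG, QA]
        rw [hpq _ (by omega), hpq _ (by omega)]
        omega
    have dn : ∀ d, a + d ≤ k → q (k - d) ∈ S := by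
      intro d
      induction d with
      | zero => intro _; exact ha
      | succ d ih =>
        intro hd
        refine hS (q (k - d)) _ ?_ (ih (by omega))
        simp only [fII, hG, QA]
        rw [hpq _ (by omega), hpq _ (by omega)]
        omega
    have dn2 : ∀ d, c + d < n → q (n - 1 - d) ∈ S := by
      intro d
      induction d with
      | zero =>
        intro _
        refine hS (q k) _ ?_ ha
        simp only [fII, hG, QA]
        rw [hpq _ (by omega), hpq _ (by omega)]
        omega
      | succ d ih =>
        intro hd
        refine hS (q (n - 1 - d)) _ ?_ (ih (by omega))
        simp only [fII, hG, QA]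
        rw [hpq _ (by omega), hpq _ (by omega)]
        omega
    intro v hv
    have hpv := hp v
    simp only [fII, Set.mem_ofPred_eq] at hv
    rw [← hqp v]
    by_cases hc : c ≤ p v
    · have := dn2 (n - 1 - p v) (by omega)
      rwa [show n - 1 - (n - 1 - p v) = p v by omega] at this
    · by_cases hk : k ≤ p v
      · have := up (p v - k) (by omega)
        rwa [show k + (p v - k) = p v by omega] at this
      · have := dn (k - p v) (by omega)
        rwa [show k - (k - p v) = p v by omega] at this

theorem classify (hkn : k + 3 ≤ n) (hpq : ∀ i < n, p (q i) = i) (hqp : ∀ v, q (p v) = v)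
    (hp : ∀ v, p v < n)
    (hG : ∀ u v, G.Adj u v ↔ QA n k (p u) (p v)) (H : G.Subgraph) (hH : H.Connected) :
    (∃ x, VI n x ∧ fI G p x = H) ∨ (∃ x, VII n k x ∧ fII n k G p x = H) := by
  classical
  -- adjacency of H in positions
  have hQ : ∀ u v, H.Adj u v → QA n k (p u) (p v) := fun u v h => (hG u v).1 h.adj_sub
  have hv1 : ∀ u v, H.Adj u v → u ∈ H.verts := fun u v h => H.edge_vert h
  have pinj : ∀ u v, p u = p v → u = v := fun u v h => by rw [← hqp u, ← hqp v, h]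
  have hexists : ∃ i, i < n ∧ q i ∈ H.verts := by
    rw [Subgraph.connected_iff] at hH
    obtain ⟨v, hv⟩ := hH.2
    exact ⟨p v, hp v, by rwa [hqp]⟩
  set a := Nat.find hexists with ha_def
  obtain ⟨han, ha⟩ := Nat.find_spec hexists
  rw [← ha_def] at han ha
  have hamin : ∀ v ∈ H.verts, a ≤ p v := fun v hv => Nat.find_min' hexists ⟨hp v, by rwa [hqp]⟩
  -- cut lemma in positions
  have cut : ∀ (S : ℕ → Prop) (i j : ℕ), i < n → j < n → q i ∈ H.verts → q j ∈ H.verts → S i → ¬ S j →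
      ∃ x y, x < n ∧ y < n ∧ H.Adj (q x) (q y) ∧ QA n k x y ∧ S x ∧ ¬ S y := by
    intro S i j hi hj hiv hjv hSi hSj
    obtain ⟨x, y, h, hx, hy⟩ := closed_of_conn H hH {v | S (p v)} (q i) (q j) hiv hjv
      (by simpa [hpq i hi] using hSi) (by simpa [hpq j hj] using hSj)
    exact ⟨p x, p y, hp x, hp y, by rwa [hqp, hqp], hQ _ _ h, hx, hy⟩
  by_cases he : H.Adj (q k) (q (n - 1))
  · right
    have hkv : q k ∈ H.verts := hv1 _ _ he
    have hnv : q (n - 1) ∈ H.verts := hv1 _ _ he.symm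
    have hak : a ≤ k := by have := hamin _ hkv; rwa [hpq k (by omega)] at this
    have low : ∀ i, a ≤ i → i < k → H.Adj (q i) (q (i + 1)) := by
      intro i h1 h2
      obtain ⟨x, y, hx, hy, hxy, hq, hSx, hSy⟩ := cut (fun t => t ≤ i) a k (by omega) (by omega) ha hkv
        h1 (by simpa using h2)
      simp only [QA] at hq
      have e1 : x = i := by omega
      have e2 : y = i + 1 := by omega
      rwa [e1, e2] at hxy
    by_cases hfull : ∀ i, k ≤ i → i + 1 < n → H.Adj (q i) (q (i + 1))
    · refine ⟨(a, n - 1, n), ⟨hak, Or.inr ⟨?_, rfl⟩⟩, ?_⟩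
      · simp only; omega
      have hall : ∀ i, a ≤ i → i + 1 < n → H.Adj (q i) (q (i + 1)) := fun i h1 h2 => by
        by_cases h : i < k
        · exact low i h1 h
        · exact hfull i (by omega) h2
      have hverts : ∀ v, v ∈ H.verts ↔ a ≤ p v := by
        intro v
        refine ⟨hamin v, fun h => ?_⟩
        have h3 := hp v
        by_cases h2 : p v + 1 < n
        · have := hv1 _ _ (hall (p v) h h2); rwa [hqp] at this
        · rw [← hqp v, show p v = n - 1 by omega]; exact hnv
      ext u v
      · simp only [fII, Set.mem_ofPred_eq, hverts]; have := hp u; omega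
      · simp only [fII]
        have hpu := hp u
        have hpv := hp v
        constructor
        · rintro ⟨-, h1, h2, h3⟩
          have : (p u + 1 = p v) ∨ (p v + 1 = p u) ∨ (p u = k ∧ p v = n - 1) ∨ (p v = k ∧ p u = n - 1) := by
            omega
          rcases this with h | h | ⟨h, h'⟩ | ⟨h, h'⟩
          · have := hall (p u) (by omega) (by omega); rwa [h, hqp, hqp] at this
          · have := hall (p v) (by omega) (by omega); rw [h, hqp, hqp] at this; exact this.symm
          · rwa [← h, ← h', hqp, hqp] at he
          · rw [← h, ← h', hqp, hqp] at he; exact he.symm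
        · intro h
          have h1 := hamin _ (hv1 _ _ h)
          have h2 := hamin _ (hv1 _ _ h.symm)
          have h3 := hQ _ _ h
          refine ⟨h.adj_sub, by omega, by omega, ?_⟩
          simp only [QA] at h3; omega
    · push Not at hfull
      set b := Nat.find hfull with hb_def
      obtain ⟨hkb, hbn, hb⟩ := Nat.find_spec hfull
      rw [← hb_def] at hkb hbn hb
      have hbmin : ∀ i, k ≤ i → i < b → H.Adj (q i) (q (i + 1)) := by
        intro i h1 h2
        by_contra h3
        exact Nat.find_min hfull h2 ⟨h1, by omega, h3⟩
      -- largest missing edge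
      have hex2 : ∃ d, d + 2 ≤ n ∧ k ≤ n - 2 - d ∧ ¬ H.Adj (q (n - 2 - d)) (q (n - 2 - d + 1)) :=
        ⟨n - 2 - b, by omega, by omega, by rwa [show n - 2 - (n - 2 - b) = b by omega]⟩
      obtain ⟨c, hkc, hcn, hc, hcmax⟩ : ∃ c, b < c ∧ c < n ∧ ¬ H.Adj (q (c - 1)) (q c) ∧
          ∀ i, c ≤ i → i + 1 < n → H.Adj (q i) (q (i + 1)) := by
        obtain ⟨h1, h2, h3⟩ := Nat.find_spec hex2
        have h4 : Nat.find hex2 ≤ n - 2 - b := Nat.find_min' hex2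
          ⟨by omega, by omega, by rwa [show n - 2 - (n - 2 - b) = b by omega]⟩
        refine ⟨n - 2 - Nat.find hex2 + 1, by omega, by omega, by simpa using h3, ?_⟩
        intro i h5 h6
        by_contra h7
        refine Nat.find_min hex2 (m := n - 2 - i) (by omega) ⟨by omega, by omega, ?_⟩
        rwa [show n - 2 - (n - 2 - i) = i by omega]
      have hlow : ∀ i, a ≤ i → i < b → H.Adj (q i) (q (i + 1)) := fun i h1 h2 => by
        by_cases h : i < k
        · exact low i h1 h
        · exact hbmin i (by omega) h2
      have hmid : ∀ v ∈ H.verts, ¬ (b < p v ∧ p v < c) := by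
        rintro v hv ⟨h1, h2⟩
        obtain ⟨x, y, hx, hy, hxy, hq, hSx, hSy⟩ := cut (fun t => b < t ∧ t < c) (p v) k (hp v) (by omega)
          (by rwa [hqp]) hkv ⟨h1, h2⟩ (by omega)
        simp only [QA] at hq
        have : (x = b + 1 ∧ y = b) ∨ (x = c - 1 ∧ y = c) := by omega
        rcases this with ⟨e1, e2⟩ | ⟨e1, e2⟩
        · rw [e1, e2] at hxy; exact hb hxy.symm
        · rw [e1, e2] at hxy; exact hc hxy
      have hbv : q b ∈ H.verts := by
        rcases Nat.lt_or_ge k b with h | h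
        · have := hv1 _ _ (hlow (b - 1) (by omega) (by omega)).symm
          rwa [show b - 1 + 1 = b by omega] at this
        · rwa [show b = k by omega]
      have hverts : ∀ v, v ∈ H.verts ↔ ((a ≤ p v ∧ p v ≤ b) ∨ c ≤ p v) := by
        intro v
        have h3 := hp v
        constructor
        · intro h
          have := hamin v h
          have := hmid v h
          omega
        · intro h
          rw [← hqp v]
          by_cases h1 : p v < b
          · exact hv1 _ _ (hlow (p v) (by omega) h1)
          · by_cases h2 : p v = b
            · rwa [h2]
            · by_cases h4 : p v + 1 < n
              · exact hv1 _ _ (hcmax (p v) (by omega) h4)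
              · rwa [show p v = n - 1 by omega]
      refine ⟨(a, b, c), ⟨hak, Or.inl ⟨hkb, hkc, hcn⟩⟩, ?_⟩
      ext u v
      · simp only [fII, Set.mem_ofPred_eq, hverts]
      · simp only [fII]
        have hpu := hp u
        have hpv := hp v
        constructor
        · rintro ⟨-, h1, h2, h3⟩
          have step : ∀ u v, p u + 1 = p v → a ≤ p u → (p v ≤ b ∨ c ≤ p u) → H.Adj u v := by
            intro u v h h1 h2
            have h5 := hp v
            have : H.Adj (q (p u)) (q (p u + 1)) := by
              rcases h2 with h2 | h2
              · exact hlow _ h1 (by omega)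
              · exact hcmax _ h2 (by omega)
            rwa [h, hqp, hqp] at this
          have : (p u + 1 = p v ∧ (p v ≤ b ∨ c ≤ p u)) ∨ (p v + 1 = p u ∧ (p u ≤ b ∨ c ≤ p v)) ∨
              (p u = k ∧ p v = n - 1) ∨ (p v = k ∧ p u = n - 1) := by
            omega
          rcases this with ⟨h, h'⟩ | ⟨h, h'⟩ | ⟨h, h'⟩ | ⟨h, h'⟩
          · exact step u v h (by omega) h'
          · exact (step v u h (by omega) h').symm
          · rwa [← h, ← h', hqp, hqp] at he
          · rw [← h, ← h', hqp, hqp] at he; exact he.symm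
        · intro h
          have h1 := (hverts _).1 (hv1 _ _ h)
          have h2 := (hverts _).1 (hv1 _ _ h.symm)
          have h3 := hQ _ _ h
          refine ⟨h.adj_sub, h1, h2, ?_⟩
          have h4 : ¬ (p u = b ∧ p v = b + 1) := by
            rintro ⟨e1, e2⟩; apply hb; rwa [← e1, e1, ← e2, ← e1, hqp, hqp]
          have h5 : ¬ (p v = b ∧ p u = b + 1) := by
            rintro ⟨e1, e2⟩; apply hb; rw [← e2, ← e1, hqp, hqp]; exact h.symm
          simp only [QA] at h3; omega
  · left
    have hex3 : ∃ d, d < n ∧ q (n - 1 - d) ∈ H.verts :=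
      ⟨n - 1 - a, by omega, by rwa [show n - 1 - (n - 1 - a) = a by omega]⟩
    obtain ⟨b, hbn, hb, hbmax⟩ : ∃ b, b < n ∧ q b ∈ H.verts ∧ ∀ v ∈ H.verts, p v ≤ b := by
      obtain ⟨h1, h2⟩ := Nat.find_spec hex3
      refine ⟨n - 1 - Nat.find hex3, by omega, h2, ?_⟩
      intro v hv
      have h5 := hp v
      have := Nat.find_min' hex3 (m := n - 1 - p v)
        ⟨by omega, by rwa [show n - 1 - (n - 1 - p v) = p v by omega, hqp]⟩
      omega
    have hab : a ≤ b := by have := hamin _ hb; rwa [hpq _ hbn] at this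
    have hall : ∀ i, a ≤ i → i < b → H.Adj (q i) (q (i + 1)) := by
      intro i h1 h2
      obtain ⟨x, y, hx, hy, hxy, hq, hSx, hSy⟩ := cut (fun t => t ≤ i) a b (by omega) (by omega) ha hb
        h1 (by simpa using h2)
      simp only [QA] at hq
      have : (x = i ∧ y = i + 1) ∨ (x = k ∧ y = n - 1) ∨ (y = k ∧ x = n - 1) := by omega
      rcases this with ⟨e1, e2⟩ | ⟨e1, e2⟩ | ⟨e1, e2⟩
      · rwa [e1, e2] at hxy
      · rw [e1, e2] at hxy; exact absurd hxy he
      · rw [e1, e2] at hxy; exact absurd hxy.symm he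
    have hverts : ∀ v, v ∈ H.verts ↔ a ≤ p v ∧ p v ≤ b := by
      intro v
      refine ⟨fun h => ⟨hamin v h, hbmax v h⟩, fun h => ?_⟩
      rw [← hqp v]
      by_cases h1 : p v < b
      · exact hv1 _ _ (hall (p v) h.1 h1)
      · rwa [show p v = b by omega]
    refine ⟨(a, b), ⟨hab, hbn⟩, ?_⟩
    ext u v
    · simp only [fI, Set.mem_ofPred_eq, hverts]
    · simp only [fI]
      constructor
      · rintro ⟨-, h1, h2, h | h⟩
        · have := hall (p u) (by omega) (by omega); rwa [h, hqp, hqp] at this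
        · have := hall (p v) (by omega) (by omega); rw [h, hqp, hqp] at this; exact this.symm
      · intro h
        have h1 := (hverts _).1 (hv1 _ _ h)
        have h2 := (hverts _).1 (hv1 _ _ h.symm)
        have h3 := hQ _ _ h
        refine ⟨h.adj_sub, h1, h2, ?_⟩
        simp only [QA] at h3
        rcases h3 with h3 | h3 | ⟨e1, e2⟩ | ⟨e1, e2⟩
        · exact Or.inl h3
        · exact Or.inr h3
        · exfalso; apply he; rwa [← e1, show n - 1 = p v by omega, hqp, hqp]
        · exfalso; apply he; rw [← e1, show n - 1 = p u by omega, hqp, hqp]; exact h.symm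

theorem fI_inj (hpq : ∀ i < n, p (q i) = i) (x y : ℕ × ℕ) (hx : VI n x) (hy : VI n y)
    (h : fI G p x = fI G p y) : x = y := by
  obtain ⟨a, b⟩ := x
  obtain ⟨a', b'⟩ := y
  simp only [VI] at hx hy
  have hv : ∀ i < n, (a ≤ i ∧ i ≤ b) ↔ (a' ≤ i ∧ i ≤ b') := by
    intro i hi
    have := congrArg (fun H => q i ∈ H.verts) h
    simpa [fI, hpq i hi] using this
  have h1 := hv a (by omega)
  have h2 := hv b (by omega)
  have h3 := hv a' (by omega)
  have h4 := hv b' (by omega)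
  ext <;> simp only <;> omega

theorem fII_adj (hkn : k + 3 ≤ n) (hpq : ∀ i < n, p (q i) = i)
    (hG : ∀ u v, G.Adj u v ↔ QA n k (p u) (p v)) (x : ℕ × (ℕ × ℕ)) (hx : VII n k x)
    (i : ℕ) (hi : k ≤ i) (hn : i + 1 < n) :
    (fII n k G p x).Adj (q i) (q (i + 1)) ↔ (i + 1 ≤ x.2.1 ∨ x.2.2 ≤ i) := by
  obtain ⟨a, b, c⟩ := x
  simp only [VII] at hx
  simp only [fII, hG, QA]
  rw [hpq i (by omega), hpq (i + 1) hn]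
  omega

theorem fII_inj (hkn : k + 3 ≤ n) (hpq : ∀ i < n, p (q i) = i)
    (hG : ∀ u v, G.Adj u v ↔ QA n k (p u) (p v)) (x y : ℕ × (ℕ × ℕ)) (hx : VII n k x) (hy : VII n k y)
    (h : fII n k G p x = fII n k G p y) : x = y := by
  obtain ⟨a, b, c⟩ := x
  obtain ⟨a', b', c'⟩ := y
  simp only [VII] at hx hy
  have hv : ∀ i < n, ((a ≤ i ∧ i ≤ b) ∨ c ≤ i) ↔ ((a' ≤ i ∧ i ≤ b') ∨ c' ≤ i) := by
    intro i hi
    have := congrArg (fun H => q i ∈ H.verts) h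
    simpa [fII, hpq i hi] using this
  have hE : ∀ i, k ≤ i → i + 1 < n → ((i + 1 ≤ b ∨ c ≤ i) ↔ (i + 1 ≤ b' ∨ c' ≤ i)) := by
    intro i hi hn
    have h3 := fII_adj (q := q) hkn hpq hG (a, b, c) hx i hi hn
    have h4 := fII_adj (q := q) hkn hpq hG (a', b', c') hy i hi hn
    rw [h] at h3
    exact h3.symm.trans h4
  have h1 := hv a (by omega)
  have h2 := hv a' (by omega)
  have haa : a = a' := by clear hE hv; omega
  have hbb : b = b' := by
    rcases Nat.lt_trichotomy b b' with h | h | h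
    · have := (hE b (by omega) (by omega)).2 (Or.inl h); omega
    · exact h
    · have := (hE b' (by omega) (by omega)).1 (Or.inl h); omega
  have hcc : c = c' := by
    rcases Nat.lt_trichotomy c c' with h | h | h
    · have := (hE (c' - 1) (by omega) (by omega)).1 (Or.inr (by omega)); omega
    · exact h
    · have := (hE (c - 1) (by omega) (by omega)).2 (Or.inr (by omega)); omega
  rw [haa, hbb, hcc]

theorem fI_ne_fII (hkn : k + 3 ≤ n) (hpq : ∀ i < n, p (q i) = i)
    (hG : ∀ u v, G.Adj u v ↔ QA n k (p u) (p v)) (x : ℕ × ℕ) (y : ℕ × (ℕ × ℕ)) (hy : VII n k y) :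
    fI G p x ≠ fII n k G p y := by
  intro h
  have h2 : (fII n k G p y).Adj (q k) (q (n - 1)) := by
    simp only [VII] at hy
    simp only [fII, hG, QA]
    rw [hpq k (by omega), hpq (n - 1) (by omega)]
    omega
  rw [← h] at h2
  simp only [fI] at h2
  rw [hpq k (by omega), hpq (n - 1) (by omega)] at h2
  omega

theorem count_gen (hkn : k + 3 ≤ n) (hpq : ∀ i < n, p (q i) = i)
    (hG : ∀ u v, G.Adj u v ↔ QA n k (p u) (p v)) (S : Finset (ℕ × ℕ)) (T : Finset (ℕ × (ℕ × ℕ)))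
    (hS : ∀ x ∈ S, VI n x) (hT : ∀ x ∈ T, VII n k x) :
    (fI G p '' (S : Set (ℕ × ℕ)) ∪ fII n k G p '' (T : Set (ℕ × (ℕ × ℕ)))).ncard = S.card + T.card := by
  rw [Set.ncard_union_eq _ (S.finite_toSet.image _) (T.finite_toSet.image _),
    Set.ncard_image_of_injOn, Set.ncard_image_of_injOn, Set.ncard_coe_finset, Set.ncard_coe_finset]
  · intro x hx y hy h; exact fII_inj hkn hpq hG x y (hT x hx) (hT y hy) h
  · intro x hx y hy h; exact fI_inj hpq x y (hS x hx) (hS y hy) h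
  · rw [Set.disjoint_left]
    rintro _ ⟨x, hx, rfl⟩ ⟨y, hy, h⟩
    exact fI_ne_fII hkn hpq hG x y (hT y hy) h.symm
end

/-- parameters -/
def TT (n k : ℕ) : Finset (ℕ × ℕ) :=
  insert (n - 1, n) (((Finset.range n) ×ˢ (Finset.range n)).filter fun x => k ≤ x.1 ∧ x.1 < x.2)

def SS (n : ℕ) : Finset (ℕ × ℕ) :=
  ((Finset.range n) ×ˢ (Finset.range n)).filter fun x => x.1 ≤ x.2

theorem card_SS (n : ℕ) : 2 * (SS n).card = n * (n + 1) := by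
  have : (SS n).card = ((Finset.range (n + 1)).sigma fun b => Finset.range b).card := by
    refine Finset.card_bij' (fun x _ => ⟨x.2 + 1, x.1⟩) (fun x _ => (x.2, x.1 - 1)) ?_ ?_ ?_ ?_
    · rintro ⟨a, b⟩ h
      simp only [SS, Finset.mem_filter, Finset.mem_product, Finset.mem_range, Finset.mem_sigma] at h ⊢
      omega
    · rintro ⟨a, b⟩ h
      simp only [SS, Finset.mem_filter, Finset.mem_product, Finset.mem_range, Finset.mem_sigma] at h ⊢
      omega
    · rintro ⟨a, b⟩ h
      simp
    · rintro ⟨a, b⟩ h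
      simp only [Finset.mem_range, Finset.mem_sigma] at h
      have : a - 1 + 1 = a := by omega
      simp [this]
  rw [this, Finset.card_sigma]
  simp only [Finset.card_range]
  have := Finset.sum_range_id_mul_two (n + 1)
  rw [Nat.add_sub_cancel] at this
  linarith

theorem card_TT (k g : ℕ) : 2 * (TT (k + g) k).card = g * (g - 1) + 2 := by
  have : (((Finset.range (k + g)) ×ˢ (Finset.range (k + g))).filter
      fun x : ℕ × ℕ => k ≤ x.1 ∧ x.1 < x.2).card
      = ((Finset.range g).sigma fun b => Finset.range b).card := by
    refine Finset.card_bij' (fun x _ => ⟨x.2 - k, x.1 - k⟩) (fun x _ => (x.2 + k, x.1 + k)) ?_ ?_ ?_ ?_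
    · rintro ⟨a, b⟩ h
      simp only [Finset.mem_filter, Finset.mem_product, Finset.mem_range, Finset.mem_sigma] at h ⊢
      omega
    · rintro ⟨a, b⟩ h
      simp only [Finset.mem_filter, Finset.mem_product, Finset.mem_range, Finset.mem_sigma] at h ⊢
      omega
    · rintro ⟨a, b⟩ h
      simp only [Finset.mem_filter, Finset.mem_product, Finset.mem_range, Finset.mem_sigma] at h ⊢
      ext <;> simp only <;> omega
    · rintro ⟨a, b⟩ h
      simp
  rw [TT, Finset.card_insert_of_notMem (by simp), this, Finset.card_sigma]
  simp only [Finset.card_range]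
  have := Finset.sum_range_id_mul_two g
  linarith

theorem lollipop_counts (n k : ℕ) (hk : 1 ≤ k) (hkn : k + 3 ≤ n) :
    2 * numCSv (lollipop n k) ⟨n - 1, by omega⟩ = (n - k) ^ 2 + n + k + 2 ∧
    2 * numCS (lollipop n k) = k * ((n - k) ^ 2 + n + 3) + 2 * ((n - k) ^ 2 + 1) := by
  obtain ⟨g, rfl⟩ := Nat.exists_eq_add_of_le (show k ≤ n by omega)
  obtain ⟨p, hp_def⟩ : ∃ p : Fin (k + g) → ℕ,
      ∀ i, p i = if i.val < g then k + i.val else k + g - 1 - i.val := ⟨_, fun _ => rfl⟩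
  obtain ⟨q, hq_def⟩ : ∃ q : ℕ → Fin (k + g), ∀ i < k + g,
      (q i).val = if k ≤ i then i - k else k + g - 1 - i := by
    refine ⟨fun i => if h : i < k + g then ⟨if k ≤ i then i - k else k + g - 1 - i, ?_⟩ else
      ⟨0, by omega⟩, ?_⟩
    · split_ifs <;> omega
    · intro i hi
      simp only [dif_pos hi]
  have hp : ∀ v, p v < k + g := by
    intro v; have := v.2; rw [hp_def]; split_ifs <;> omega
  have hpq : ∀ i < k + g, p (q i) = i := by
    intro i hi
    have h1 := hq_def i hi
    rw [hp_def]
    split_ifs at h1 ⊢ <;> omega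
  have hqp : ∀ v, q (p v) = v := by
    intro v
    have h0 := v.2
    have h1 := hq_def (p v) (hp v)
    have h2 := hp_def v
    ext
    split_ifs at h1 h2 <;> omega
  have hG : ∀ u v, (lollipop (k + g) k).Adj u v ↔ QA (k + g) k (p u) (p v) := by
    intro u v
    have := u.2
    have := v.2
    simp only [lollipop, SimpleGraph.fromRel_adj, QA, hp_def, ne_eq, Fin.ext_iff]
    split_ifs <;> omega
  have hv0 : p ⟨k + g - 1, by omega⟩ = 0 := by
    simp only [hp_def]; split_ifs <;> omega
  have hTT : ∀ x, x ∈ TT (k + g) k ↔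
      ((k ≤ x.1 ∧ x.1 < x.2 ∧ x.2 < k + g) ∨ (x.1 + 1 = k + g ∧ x.2 = k + g)) := by
    rintro ⟨b, c⟩
    simp only [TT, Finset.mem_insert, Finset.mem_filter, Finset.mem_product, Finset.mem_range,
      Prod.mk.injEq]
    omega
  have hSS : ∀ x, x ∈ SS (k + g) ↔ VI (k + g) x := by
    rintro ⟨a, b⟩
    simp only [SS, Finset.mem_filter, Finset.mem_product, Finset.mem_range, VI]
    omega
  have cT := card_TT k g
  have cS := card_SS (k + g)
  have hsub : g * (g - 1) + g = g ^ 2 := by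
    obtain ⟨m, rfl⟩ : ∃ m, g = m + 1 := ⟨g - 1, by omega⟩
    simp; ring
  rw [Nat.add_sub_cancel_left]
  constructor
  · have hset : {H : (lollipop (k + g) k).Subgraph | H.Connected ∧ (⟨k + g - 1, by omega⟩ : Fin (k + g)) ∈ H.verts}
        = fI (lollipop (k + g) k) p '' (({0} ×ˢ Finset.range (k + g) : Finset (ℕ × ℕ)) : Set (ℕ × ℕ)) ∪
          fII (k + g) k (lollipop (k + g) k) p '' (({0} ×ˢ TT (k + g) k : Finset (ℕ × (ℕ × ℕ))) : Set (ℕ × (ℕ × ℕ))) := by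
      ext H
      constructor
      · rintro ⟨hc, hv⟩
        rcases classify hkn hpq hqp hp hG H hc with ⟨⟨a, b⟩, hx, rfl⟩ | ⟨⟨a, b, c⟩, hx, rfl⟩
        · left
          refine ⟨_, ?_, rfl⟩
          simp only [fI, Set.mem_ofPred_eq, hv0, VI] at hv hx
          simp
          omega
        · right
          refine ⟨_, ?_, rfl⟩
          simp only [fII, Set.mem_ofPred_eq, hv0, VII] at hv hx
          rw [Finset.mem_coe, Finset.mem_product, hTT, Finset.mem_singleton]
          simp only
          omega
      · rintro (⟨⟨a, b⟩, hx, rfl⟩ | ⟨⟨a, b, c⟩, hx, rfl⟩)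
        · simp only [Finset.mem_coe, Finset.mem_product, Finset.mem_singleton, Finset.mem_range] at hx
          refine ⟨fI_conn hkn hpq hqp hG _ ?_, ?_⟩
          · simp only [VI]; omega
          · simp only [fI, Set.mem_ofPred_eq, hv0]; omega
        · rw [Finset.mem_coe, Finset.mem_product, hTT, Finset.mem_singleton] at hx
          simp only at hx
          refine ⟨fII_conn hkn hpq hqp hp hG _ ?_, ?_⟩
          · simp only [VII]; omega
          · simp only [fII, Set.mem_ofPred_eq, hv0]; omega
    rw [numCSv, hset, count_gen hkn hpq hG]
    · simp only [Finset.card_product, Finset.card_singleton, Finset.card_range]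
      linarith
    · rintro ⟨a, b⟩ hx
      simp only [Finset.mem_product, Finset.mem_singleton, Finset.mem_range] at hx
      simp only [VI]; omega
    · rintro ⟨a, b, c⟩ hx
      rw [Finset.mem_product, hTT, Finset.mem_singleton] at hx
      simp only at hx
      simp only [VII]; omega
  · have hVII : ∀ x, x ∈ Finset.range (k + 1) ×ˢ TT (k + g) k ↔ VII (k + g) k x := by
      rintro ⟨a, b, c⟩
      rw [Finset.mem_product, hTT, Finset.mem_range]
      simp only [VII]
      omega
    have hset : {H : (lollipop (k + g) k).Subgraph | H.Connected}
        = fI (lollipop (k + g) k) p '' (SS (k + g) : Set (ℕ × ℕ)) ∪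
          fII (k + g) k (lollipop (k + g) k) p '' ((Finset.range (k + 1) ×ˢ TT (k + g) k : Finset (ℕ × (ℕ × ℕ))) : Set (ℕ × (ℕ × ℕ))) := by
      ext H
      constructor
      · intro hc
        rcases classify hkn hpq hqp hp hG H hc with ⟨x, hx, rfl⟩ | ⟨x, hx, rfl⟩
        · exact Or.inl ⟨x, (hSS x).2 hx, rfl⟩
        · exact Or.inr ⟨x, (hVII x).2 hx, rfl⟩
      · rintro (⟨x, hx, rfl⟩ | ⟨x, hx, rfl⟩)
        · exact fI_conn hkn hpq hqp hG _ ((hSS x).1 hx)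
        · exact fII_conn hkn hpq hqp hp hG _ ((hVII x).1 hx)
    rw [numCS, hset, count_gen hkn hpq hG _ _ (fun x => (hSS x).1) (fun x => (hVII x).1)]
    simp only [Finset.card_product, Finset.card_range]
    have e : 2 * ((SS (k + g)).card + (k + 1) * (TT (k + g) k).card)
      = 2 * (SS (k + g)).card + (k + 1) * (2 * (TT (k + g) k).card) := by ring
    rw [e, cS, cT, ← hsub]
    nlinarith [hsub]
end
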